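/- (Theorem A, part 2) The correspondence V ↦ Soc(Coind_{𝔤≥0}^𝔤(V)) ≅ Soc(K(V ⊗ Λ^max(𝔤₋₁*))) induces a bijection between the set of isomorphism classes of simple 𝔤₀̄-supermodules and the set of isomorphism classes of simple 𝔤-supermodules. -/

import Mathlib

noncomputable section

open Module Function

/-- A complex Lie superalgebra `𝔤 = 𝔤₀̄ ⊕ 𝔤₁̄` equipped with a compatible `ℤ`-grading
`𝔤 = 𝔤₋₁ ⊕ 𝔤₀ ⊕ 𝔤₁`, i.e. `𝔤₀ = 𝔤₀̄`, `𝔤₁̄ = 𝔤₁ ⊕ 𝔤₋₁`, the pieces `𝔤±₁` are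
`𝔤₀̄`-submodules and `[𝔤₁,𝔤₁] = [𝔤₋₁,𝔤₋₁] = 0`.  The super skew-symmetry and the super
Jacobi identity are imposed on (parity-)homogeneous elements, as usual. -/
structure GLSA where
  carrier : Type
  [isACG : AddCommGroup carrier]
  [isMod : Module ℂ carrier]
  bracket : carrier →ₗ[ℂ] carrier →ₗ[ℂ] carrier
  gneg : Submodule ℂ carrier
  g0 : Submodule ℂ carrier
  gpos : Submodule ℂ carrier
  oddCompl : IsCompl g0 (gneg ⊔ gpos)
  disjNP : Disjoint gneg gpos
  br_00 : ∀ x ∈ g0, ∀ y ∈ g0, bracket x y ∈ g0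
  br_0p : ∀ x ∈ g0, ∀ y ∈ gpos, bracket x y ∈ gpos
  br_0n : ∀ x ∈ g0, ∀ y ∈ gneg, bracket x y ∈ gneg
  br_pn : ∀ x ∈ gpos, ∀ y ∈ gneg, bracket x y ∈ g0
  br_pp : ∀ x ∈ gpos, ∀ y ∈ gpos, bracket x y = 0
  br_nn : ∀ x ∈ gneg, ∀ y ∈ gneg, bracket x y = 0
  skew_e : ∀ x ∈ g0, ∀ y, bracket x y = - bracket y x
  skew_oo : ∀ x ∈ gneg ⊔ gpos, ∀ y ∈ gneg ⊔ gpos, bracket x y = bracket y x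
  jacobi_e : ∀ x y z : carrier, (x ∈ g0 ∨ y ∈ g0) →
    bracket x (bracket y z) = bracket (bracket x y) z + bracket y (bracket x z)
  jacobi_oo : ∀ x ∈ gneg ⊔ gpos, ∀ y ∈ gneg ⊔ gpos, ∀ z,
    bracket x (bracket y z) = bracket (bracket x y) z - bracket y (bracket x z)

attribute [instance] GLSA.isACG GLSA.isMod

/-- The odd part `𝔤₁̄ = 𝔤₋₁ ⊕ 𝔤₁` of `L`. -/
def GLSA.odd (L : GLSA) : Submodule ℂ L.carrier := L.gneg ⊔ L.gpos

/-- A `𝔤`-supermodule: a `ℤ₂`-graded complex vector space with a compatible action of the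
Lie superalgebra `L` (signs in the compatibility with the bracket are imposed on
homogeneous elements). -/
structure SMod (L : GLSA) where
  carrier : Type
  [isACG : AddCommGroup carrier]
  [isMod : Module ℂ carrier]
  act : L.carrier →ₗ[ℂ] carrier →ₗ[ℂ] carrier
  ev : Submodule ℂ carrier
  od : Submodule ℂ carrier
  grading : IsCompl ev od
  act_e_ev : ∀ x ∈ L.g0, ∀ m ∈ ev, act x m ∈ ev
  act_e_od : ∀ x ∈ L.g0, ∀ m ∈ od, act x m ∈ od
  act_o_ev : ∀ x ∈ L.odd, ∀ m ∈ ev, act x m ∈ od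
  act_o_od : ∀ x ∈ L.odd, ∀ m ∈ od, act x m ∈ ev
  act_br_e : ∀ x y : L.carrier, (x ∈ L.g0 ∨ y ∈ L.g0) → ∀ m,
    act (L.bracket x y) m = act x (act y m) - act y (act x m)
  act_br_oo : ∀ x ∈ L.odd, ∀ y ∈ L.odd, ∀ m,
    act (L.bracket x y) m = act x (act y m) + act y (act x m)

attribute [instance] SMod.isACG SMod.isMod

/-- A `𝔤₀̄`-supermodule: a `ℤ₂`-graded complex vector space with an action of the (purely
even) Lie algebra `𝔤₀̄ = 𝔤₀` preserving the grading. -/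
structure SMod0 (L : GLSA) where
  carrier : Type
  [isACG : AddCommGroup carrier]
  [isMod : Module ℂ carrier]
  act : ↥L.g0 →ₗ[ℂ] carrier →ₗ[ℂ] carrier
  ev : Submodule ℂ carrier
  od : Submodule ℂ carrier
  grading : IsCompl ev od
  act_ev : ∀ (x : L.g0), ∀ m ∈ ev, act x m ∈ ev
  act_od : ∀ (x : L.g0), ∀ m ∈ od, act x m ∈ od
  act_br : ∀ (x y : L.g0) (m : carrier),
    act ⟨L.bracket ↑x ↑y, L.br_00 ↑x x.2 ↑y y.2⟩ m = act x (act y m) - act y (act x m)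

attribute [instance] SMod0.isACG SMod0.isMod

/-- A homomorphism of `𝔤`-supermodules (homogeneous of degree zero). -/
structure SHom {L : GLSA} (M N : SMod L) where
  toLin : M.carrier →ₗ[ℂ] N.carrier
  map_ev : ∀ m ∈ M.ev, toLin m ∈ N.ev
  map_od : ∀ m ∈ M.od, toLin m ∈ N.od
  equivar : ∀ (x : L.carrier) (m : M.carrier), toLin (M.act x m) = N.act x (toLin m)

/-- Isomorphism of `𝔤`-supermodules. -/
def SIso {L : GLSA} (M N : SMod L) : Prop := ∃ f : SHom M N, Bijective f.toLin

/-- Isomorphism of `𝔤₀̄`-supermodules. -/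
def SIso0 {L : GLSA} (V W : SMod0 L) : Prop :=
  ∃ e : V.carrier ≃ₗ[ℂ] W.carrier,
    (∀ v ∈ V.ev, e v ∈ W.ev) ∧ (∀ v ∈ V.od, e v ∈ W.od) ∧
    (∀ (x : L.g0) (v : V.carrier), e (V.act x v) = W.act x (e v))

/-- Isomorphism of `𝔤`-supermodules up to parity change. -/
def SIsoUpToParity {L : GLSA} (M N : SMod L) : Prop :=
  ∃ e : M.carrier ≃ₗ[ℂ] N.carrier,
    (∀ (x : L.carrier) (m : M.carrier), e (M.act x m) = N.act x (e m)) ∧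
    (((∀ m ∈ M.ev, e m ∈ N.ev) ∧ (∀ m ∈ M.od, e m ∈ N.od)) ∨
     ((∀ m ∈ M.ev, e m ∈ N.od) ∧ (∀ m ∈ M.od, e m ∈ N.ev)))

namespace SMod

variable {L : GLSA}

/-- A (graded) sub-supermodule of a `𝔤`-supermodule. -/
def IsSubmod (M : SMod L) (N : Submodule ℂ M.carrier) : Prop :=
  (∀ (x : L.carrier), ∀ m ∈ N, M.act x m ∈ N) ∧ N ≤ (N ⊓ M.ev) ⊔ (N ⊓ M.od)

/-- A simple sub-supermodule. -/
def IsSimpleSub (M : SMod L) (N : Submodule ℂ M.carrier) : Prop :=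
  M.IsSubmod N ∧ N ≠ ⊥ ∧ ∀ N', M.IsSubmod N' → N' ≤ N → N' = ⊥ ∨ N' = N

/-- The socle: the sum of all simple sub-supermodules. -/
def socle (M : SMod L) : Submodule ℂ M.carrier := sSup {N | M.IsSimpleSub N}

/-- The sub-supermodule generated by a subspace, i.e. `U(𝔤)·S`. -/
def gen (M : SMod L) (S : Submodule ℂ M.carrier) : Submodule ℂ M.carrier :=
  sInf {N | M.IsSubmod N ∧ S ≤ N}

/-- Simplicity of a `𝔤`-supermodule. -/
def IsSimple (M : SMod L) : Prop :=
  (⊤ : Submodule ℂ M.carrier) ≠ ⊥ ∧ ∀ N, M.IsSubmod N → N = ⊥ ∨ N = ⊤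

/-- Indecomposability of a `𝔤`-supermodule. -/
def Indecomposable (M : SMod L) : Prop :=
  (⊤ : Submodule ℂ M.carrier) ≠ ⊥ ∧
  ∀ N₁ N₂, M.IsSubmod N₁ → M.IsSubmod N₂ → N₁ ⊓ N₂ = ⊥ → N₁ ⊔ N₂ = ⊤ →
    N₁ = ⊥ ∨ N₂ = ⊥

/-- The parity change functor `Π`. -/
def pshift (M : SMod L) : SMod L where
  carrier := M.carrier
  act := M.act
  ev := M.od
  od := M.ev
  grading := M.grading.symm
  act_e_ev := M.act_e_od
  act_e_od := M.act_e_ev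
  act_o_ev := M.act_o_od
  act_o_od := M.act_o_ev
  act_br_e := M.act_br_e
  act_br_oo := M.act_br_oo

/-- The space `M^{𝔤₁}` of `𝔤₁`-invariants. -/
def invPos (M : SMod L) : Submodule ℂ M.carrier where
  carrier := {m | ∀ x ∈ L.gpos, M.act x m = 0}
  add_mem' := by
    intro a b ha hb x hx
    rw [map_add, ha x hx, hb x hx, add_zero]
  zero_mem' := by intro x hx; simp
  smul_mem' := by
    intro c a ha x hx
    rw [map_smul, ha x hx, smul_zero]

/-- The space `M^{𝔤₋₁}` of `𝔤₋₁`-invariants. -/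
def invNeg (M : SMod L) : Submodule ℂ M.carrier where
  carrier := {m | ∀ x ∈ L.gneg, M.act x m = 0}
  add_mem' := by
    intro a b ha hb x hx
    rw [map_add, ha x hx, hb x hx, add_zero]
  zero_mem' := by intro x hx; simp
  smul_mem' := by
    intro c a ha x hx
    rw [map_smul, ha x hx, smul_zero]

/-- Iterated action of a list of elements of `𝔤`. -/
def actList (M : SMod L) : List L.carrier → M.carrier → M.carrier
  | [], m => m
  | x :: xs, m => M.act x (M.actList xs m)

end SMod

namespace SMod0

variable {L : GLSA}

/-- A (graded) sub-supermodule of a `𝔤₀̄`-supermodule. -/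
def IsSubmod (V : SMod0 L) (N : Submodule ℂ V.carrier) : Prop :=
  (∀ (x : L.g0), ∀ v ∈ N, V.act x v ∈ N) ∧ N ≤ (N ⊓ V.ev) ⊔ (N ⊓ V.od)

/-- Simplicity of a `𝔤₀̄`-supermodule. -/
def IsSimple (V : SMod0 L) : Prop :=
  (⊤ : Submodule ℂ V.carrier) ≠ ⊥ ∧ ∀ N, V.IsSubmod N → N = ⊥ ∨ N = ⊤

end SMod0

/-- `IsKac V K η` expresses that `K`, together with the (even, `𝔤₀̄`-equivariant) unit map
`η : V → K` whose image is annihilated by `𝔤₁`, is *the* Kac module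
`K(V) = Ind_{𝔤≥0}^{𝔤} V` of the `𝔤₀̄`-supermodule `V` (on which `𝔤₁` acts by zero), i.e.
satisfies the universal property `Hom_𝔤(K(V), M) = Hom_{𝔤₀̄}(V, M^{𝔤₁})`. -/
structure IsKac {L : GLSA} (V : SMod0 L) (K : SMod L) (η : V.carrier →ₗ[ℂ] K.carrier) : Prop where
  map_ev : ∀ v ∈ V.ev, η v ∈ K.ev
  map_od : ∀ v ∈ V.od, η v ∈ K.od
  equivar : ∀ (x : L.g0) (v : V.carrier), η (V.act x v) = K.act ↑x (η v)
  pos_zero : ∀ x ∈ L.gpos, ∀ v : V.carrier, K.act x (η v) = 0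
  injective : Injective η
  generates : K.gen (LinearMap.range η) = ⊤
  universal : ∀ (M : SMod L) (φ : V.carrier →ₗ[ℂ] M.carrier),
    (∀ v ∈ V.ev, φ v ∈ M.ev) → (∀ v ∈ V.od, φ v ∈ M.od) →
    (∀ (x : L.g0) (v : V.carrier), φ (V.act x v) = M.act ↑x (φ v)) →
    (∀ x ∈ L.gpos, ∀ v : V.carrier, M.act x (φ v) = 0) →
    ∃! Φ : SHom K M, ∀ v, Φ.toLin (η v) = φ v

/-- The opposite Kac module `K'(V) = Ind_{𝔤≤0}^{𝔤} V` (with `𝔤₋₁` acting by zero on `V`),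
described by its universal property. -/
structure IsKac' {L : GLSA} (V : SMod0 L) (K : SMod L) (η : V.carrier →ₗ[ℂ] K.carrier) : Prop where
  map_ev : ∀ v ∈ V.ev, η v ∈ K.ev
  map_od : ∀ v ∈ V.od, η v ∈ K.od
  equivar : ∀ (x : L.g0) (v : V.carrier), η (V.act x v) = K.act ↑x (η v)
  neg_zero : ∀ x ∈ L.gneg, ∀ v : V.carrier, K.act x (η v) = 0
  injective : Injective η
  generates : K.gen (LinearMap.range η) = ⊤
  universal : ∀ (M : SMod L) (φ : V.carrier →ₗ[ℂ] M.carrier),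
    (∀ v ∈ V.ev, φ v ∈ M.ev) → (∀ v ∈ V.od, φ v ∈ M.od) →
    (∀ (x : L.g0) (v : V.carrier), φ (V.act x v) = M.act ↑x (φ v)) →
    (∀ x ∈ L.gneg, ∀ v : V.carrier, M.act x (φ v) = 0) →
    ∃! Φ : SHom K M, ∀ v, Φ.toLin (η v) = φ v

/-- `IsCoindPos W C ε` expresses that `C`, together with the (even, `𝔤₀̄`-equivariant)
counit `ε : C → W` killing `𝔤₁·C`, is the coinduced module `Coind_{𝔤≥0}^{𝔤}(W)` of the
`𝔤₀̄`-supermodule `W` (with `𝔤₁` acting by zero), i.e. satisfies the universal property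
`Hom_𝔤(M, Coind(W)) = Hom_{𝔤≥0}(Res M, W)`. -/
structure IsCoindPos {L : GLSA} (W : SMod0 L) (C : SMod L) (ε : C.carrier →ₗ[ℂ] W.carrier) : Prop where
  map_ev : ∀ c ∈ C.ev, ε c ∈ W.ev
  map_od : ∀ c ∈ C.od, ε c ∈ W.od
  equivar : ∀ (x : L.g0) (c : C.carrier), ε (C.act ↑x c) = W.act x (ε c)
  pos_zero : ∀ x ∈ L.gpos, ∀ c : C.carrier, ε (C.act x c) = 0
  universal : ∀ (M : SMod L) (ψ : M.carrier →ₗ[ℂ] W.carrier),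
    (∀ m ∈ M.ev, ψ m ∈ W.ev) → (∀ m ∈ M.od, ψ m ∈ W.od) →
    (∀ (x : L.g0) (m : M.carrier), ψ (M.act ↑x m) = W.act x (ψ m)) →
    (∀ x ∈ L.gpos, ∀ m : M.carrier, ψ (M.act x m) = 0) →
    ∃! Φ : SHom M C, ∀ m, ε (Φ.toLin m) = ψ m

/-- `Coind_{𝔤≤0}^{𝔤}(W)`, by its universal property. -/
structure IsCoindNeg {L : GLSA} (W : SMod0 L) (C : SMod L) (ε : C.carrier →ₗ[ℂ] W.carrier) : Prop where
  map_ev : ∀ c ∈ C.ev, ε c ∈ W.ev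
  map_od : ∀ c ∈ C.od, ε c ∈ W.od
  equivar : ∀ (x : L.g0) (c : C.carrier), ε (C.act ↑x c) = W.act x (ε c)
  neg_zero : ∀ x ∈ L.gneg, ∀ c : C.carrier, ε (C.act x c) = 0
  universal : ∀ (M : SMod L) (ψ : M.carrier →ₗ[ℂ] W.carrier),
    (∀ m ∈ M.ev, ψ m ∈ W.ev) → (∀ m ∈ M.od, ψ m ∈ W.od) →
    (∀ (x : L.g0) (m : M.carrier), ψ (M.act ↑x m) = W.act x (ψ m)) →
    (∀ x ∈ L.gneg, ∀ m : M.carrier, ψ (M.act x m) = 0) →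
    ∃! Φ : SHom M C, ∀ m, ε (Φ.toLin m) = ψ m

/-- The subspace `Λ^max(𝔤₋₁) ⊗ V ⊆ K(V)`: the span of all elements obtained by acting on
`η(V)` with `dim 𝔤₋₁` many elements of `𝔤₋₁`. -/
def botPartNeg {L : GLSA} (V : SMod0 L) (K : SMod L) (η : V.carrier →ₗ[ℂ] K.carrier) :
    Submodule ℂ K.carrier :=
  Submodule.span ℂ {m | ∃ (xs : List L.carrier) (v : V.carrier),
    xs.length = finrank ℂ ↥L.gneg ∧ (∀ x ∈ xs, x ∈ L.gneg) ∧ m = K.actList xs (η v)}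

/-- The subspace `Λ^max(𝔤₁) ⊗ V ⊆ K'(V)`. -/
def botPartPos {L : GLSA} (V : SMod0 L) (K : SMod L) (η : V.carrier →ₗ[ℂ] K.carrier) :
    Submodule ℂ K.carrier :=
  Submodule.span ℂ {m | ∃ (xs : List L.carrier) (v : V.carrier),
    xs.length = finrank ℂ ↥L.gpos ∧ (∀ x ∈ xs, x ∈ L.gpos) ∧ m = K.actList xs (η v)}

/-- For `x ∈ 𝔤₀̄`, the operator `ad x` restricted to `𝔤₁`. -/
def adPos (L : GLSA) (x : L.g0) : ↥L.gpos →ₗ[ℂ] ↥L.gpos :=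
  (L.bracket ↑x).restrict (fun y hy => L.br_0p ↑x x.2 y hy)

/-- For `x ∈ 𝔤₀̄`, the operator `ad x` restricted to `𝔤₋₁`. -/
def adNeg (L : GLSA) (x : L.g0) : ↥L.gneg →ₗ[ℂ] ↥L.gneg :=
  (L.bracket ↑x).restrict (fun y hy => L.br_0n ↑x x.2 y hy)

/-- The character by which `𝔤₀̄` acts on the one-dimensional module `Λ^max(𝔤₁)`. -/
def traceCharPos (L : GLSA) (x : L.g0) : ℂ := LinearMap.trace ℂ ↥L.gpos (adPos L x)

/-- The character by which `𝔤₀̄` acts on the one-dimensional module `Λ^max(𝔤₋₁)`. -/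
def traceCharNeg (L : GLSA) (x : L.g0) : ℂ := LinearMap.trace ℂ ↥L.gneg (adNeg L x)

/-- `IsTwistBy V W χ swap` expresses that `W ≅ ℂ_χ ⊗ V` as `𝔤₀̄`-supermodules, where `ℂ_χ`
is the one-dimensional module with character `χ`, of odd parity iff `swap = true`.
Taking `χ` to be `traceCharPos`/`traceCharNeg` (resp. their negatives) and `swap` the parity
of `dim 𝔤±₁` expresses `W ≅ Λ^max(𝔤±₁) ⊗ V` (resp. `W ≅ Λ^max(𝔤±₁^*) ⊗ V`). -/
def IsTwistBy {L : GLSA} (V W : SMod0 L) (χ : ↥L.g0 → ℂ) (swap : Bool) : Prop :=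
  ∃ e : V.carrier ≃ₗ[ℂ] W.carrier,
    (∀ (x : L.g0) (v : V.carrier), W.act x (e v) = e (V.act x v) + χ x • e v) ∧
    (if swap then (∀ v ∈ V.ev, e v ∈ W.od) ∧ (∀ v ∈ V.od, e v ∈ W.ev)
     else (∀ v ∈ V.ev, e v ∈ W.ev) ∧ (∀ v ∈ V.od, e v ∈ W.od))

/-- Parity (as a `Bool`) of `dim 𝔤₁`. -/
def parPos (L : GLSA) : Bool := (finrank ℂ ↥L.gpos) % 2 == 1

/-- Parity (as a `Bool`) of `dim 𝔤₋₁`. -/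
def parNeg (L : GLSA) : Bool := (finrank ℂ ↥L.gneg) % 2 == 1

section Involutions

variable {X Y : Type} [AddCommGroup X] [Module ℂ X] [AddCommGroup Y] [Module ℂ Y]

/-- The parity involution attached to a decomposition `X = A ⊕ B`: it is `1` on `A` and `-1`
on `B`. -/
def parityOp {A B : Submodule ℂ X} (h : IsCompl A B) : X →ₗ[ℂ] X :=
  (2 : ℂ) • A.projection B h - LinearMap.id

theorem parityOp_left {A B : Submodule ℂ X} (h : IsCompl A B) {m : X} (hm : m ∈ A) :
    parityOp h m = m := by
  simp only [parityOp, LinearMap.sub_apply, LinearMap.smul_apply, LinearMap.id_apply,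
    Submodule.projection_apply_of_mem_left h hm]
  module

theorem parityOp_right {A B : Submodule ℂ X} (h : IsCompl A B) {m : X} (hm : m ∈ B) :
    parityOp h m = -m := by
  simp only [parityOp, LinearMap.sub_apply, LinearMap.smul_apply, LinearMap.id_apply,
    (Submodule.projection_apply_eq_zero_iff h).2 hm]
  module

theorem exists_add_of_isCompl {A B : Submodule ℂ X} (h : IsCompl A B) (m : X) :
    ∃ a ∈ A, ∃ b ∈ B, m = a + b := by
  have : m ∈ A ⊔ B := h.sup_eq_top ▸ Submodule.mem_top
  obtain ⟨a, ha, b, hb, e⟩ := Submodule.mem_sup.1 this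
  exact ⟨a, ha, b, hb, e.symm⟩

theorem parityOp_parityOp {A B : Submodule ℂ X} (h : IsCompl A B) (m : X) :
    parityOp h (parityOp h m) = m := by
  obtain ⟨a, ha, b, hb, rfl⟩ := exists_add_of_isCompl h m
  simp [parityOp_left h ha, parityOp_right h hb]

theorem add_parityOp_mem {A B : Submodule ℂ X} (h : IsCompl A B) (m : X) :
    m + parityOp h m ∈ A := by
  obtain ⟨a, ha, b, hb, rfl⟩ := exists_add_of_isCompl h m
  have : a + b + parityOp h (a + b) = a + a := by
    rw [map_add, parityOp_left h ha, parityOp_right h hb]; abel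
  rw [this]; exact A.add_mem ha ha

theorem sub_parityOp_mem {A B : Submodule ℂ X} (h : IsCompl A B) (m : X) :
    m - parityOp h m ∈ B := by
  obtain ⟨a, ha, b, hb, rfl⟩ := exists_add_of_isCompl h m
  have : a + b - parityOp h (a + b) = b + b := by
    rw [map_add, parityOp_left h ha, parityOp_right h hb]; abel
  rw [this]; exact B.add_mem hb hb

theorem mem_of_two_smul_mem {A : Submodule ℂ X} {m : X} (h : m + m ∈ A) : m ∈ A := by
  have := A.smul_mem (2⁻¹ : ℂ) h
  rwa [← two_smul ℂ m, smul_smul, inv_mul_cancel₀ two_ne_zero, one_smul] at this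

theorem parityOp_eq_self_iff {A B : Submodule ℂ X} (h : IsCompl A B) {m : X} :
    parityOp h m = m ↔ m ∈ A := by
  refine ⟨fun e => mem_of_two_smul_mem ?_, parityOp_left h⟩
  have := add_parityOp_mem h m
  rwa [e] at this

theorem parityOp_eq_neg_iff {A B : Submodule ℂ X} (h : IsCompl A B) {m : X} :
    parityOp h m = -m ↔ m ∈ B := by
  refine ⟨fun e => mem_of_two_smul_mem ?_, parityOp_right h⟩
  have := sub_parityOp_mem h m
  rwa [e, sub_neg_eq_add] at this

theorem le_inf_sup_inf_iff {A B : Submodule ℂ X} (h : IsCompl A B) (N : Submodule ℂ X) :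
    N ≤ (N ⊓ A) ⊔ (N ⊓ B) ↔ ∀ m ∈ N, parityOp h m ∈ N := by
  constructor
  · intro hN m hm
    obtain ⟨a, ha, b, hb, rfl⟩ := Submodule.mem_sup.1 (hN hm)
    rw [map_add, parityOp_left h ha.2, parityOp_right h hb.2]
    exact N.add_mem ha.1 (N.neg_mem hb.1)
  · intro hN m hm
    apply mem_of_two_smul_mem
    have : m + m = (m + parityOp h m) + (m - parityOp h m) := by abel
    rw [this]
    exact Submodule.add_mem_sup ⟨N.add_mem hm (hN m hm), add_parityOp_mem h m⟩
      ⟨N.sub_mem hm (hN m hm), sub_parityOp_mem h m⟩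

theorem map_parityOp {A B : Submodule ℂ X} (h : IsCompl A B) {A' B' : Submodule ℂ Y}
    (h' : IsCompl A' B') (f : X →ₗ[ℂ] Y) (hA : ∀ m ∈ A, f m ∈ A') (hB : ∀ m ∈ B, f m ∈ B')
    (m : X) : f (parityOp h m) = parityOp h' (f m) := by
  obtain ⟨a, ha, b, hb, rfl⟩ := exists_add_of_isCompl h m
  simp only [map_add, parityOp_left h ha, parityOp_right h hb, map_neg,
    parityOp_left h' (hA a ha), parityOp_right h' (hB b hb)]

theorem map_parityOp_swap {A B : Submodule ℂ X} (h : IsCompl A B) {A' B' : Submodule ℂ Y}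
    (h' : IsCompl A' B') (f : X →ₗ[ℂ] Y) (hA : ∀ m ∈ A, f m ∈ B') (hB : ∀ m ∈ B, f m ∈ A')
    (m : X) : f (parityOp h m) = -parityOp h' (f m) := by
  obtain ⟨a, ha, b, hb, rfl⟩ := exists_add_of_isCompl h m
  simp only [map_add, parityOp_left h ha, parityOp_right h hb, map_neg,
    parityOp_right h' (hA a ha), parityOp_left h' (hB b hb), neg_add, neg_neg]

/-- The `1`-eigenspace of `σ`. -/
def plusSpace (σ : X →ₗ[ℂ] X) : Submodule ℂ X := LinearMap.ker (σ - LinearMap.id)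

/-- The `-1`-eigenspace of `σ`. -/
def minusSpace (σ : X →ₗ[ℂ] X) : Submodule ℂ X := LinearMap.ker (σ + LinearMap.id)

theorem mem_plusSpace {σ : X →ₗ[ℂ] X} {m : X} : m ∈ plusSpace σ ↔ σ m = m := by
  simp [plusSpace, sub_eq_zero]

theorem mem_minusSpace {σ : X →ₗ[ℂ] X} {m : X} : m ∈ minusSpace σ ↔ σ m = -m := by
  simp [minusSpace, add_eq_zero_iff_eq_neg]

theorem isCompl_plusSpace_minusSpace {σ : X →ₗ[ℂ] X} (hσ : ∀ m, σ (σ m) = m) :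
    IsCompl (plusSpace σ) (minusSpace σ) := by
  constructor
  · rw [Submodule.disjoint_def]
    intro m h1 h2
    rw [mem_plusSpace] at h1
    rw [mem_minusSpace, h1] at h2
    have : (2 : ℂ) • m = 0 := by rw [two_smul]; exact add_eq_zero_iff_eq_neg.2 h2
    exact (smul_eq_zero.1 this).resolve_left two_ne_zero
  · rw [codisjoint_iff, eq_top_iff]
    intro m _
    apply mem_of_two_smul_mem
    have : m + m = (m + σ m) + (m - σ m) := by abel
    rw [this]
    refine Submodule.add_mem_sup ?_ ?_
    · rw [mem_plusSpace, map_add, hσ, add_comm]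
    · rw [mem_minusSpace, map_sub, hσ, neg_sub]

theorem parityOp_plusSpace_minusSpace {σ : X →ₗ[ℂ] X} (hσ : ∀ m, σ (σ m) = m) (m : X) :
    parityOp (isCompl_plusSpace_minusSpace hσ) m = σ m := by
  obtain ⟨a, ha, b, hb, rfl⟩ := exists_add_of_isCompl (isCompl_plusSpace_minusSpace hσ) m
  rw [map_add, parityOp_left _ ha, parityOp_right _ hb, map_add, mem_plusSpace.1 ha,
    mem_minusSpace.1 hb]

end Involutions

section SquareZero

variable {X Y : Type} [AddCommGroup X] [Module ℂ X] [AddCommGroup Y] [Module ℂ Y]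

theorem anticomm_of_sq_zero {a : Y →ₗ[ℂ] X →ₗ[ℂ] X} (ha : ∀ y m, a y (a y m) = 0) (y z : Y)
    (m : X) : a y (a z m) = -a z (a y m) := by
  have := ha (y + z) m
  simp only [map_add, LinearMap.add_apply, ha, zero_add, add_zero] at this
  exact eq_neg_of_add_eq_zero_right this

/-- Pairwise anticommuting square-zero operators have a common null vector. -/
theorem exists_common_null [FiniteDimensional ℂ Y] {a : Y →ₗ[ℂ] X →ₗ[ℂ] X}
    (ha : ∀ y m, a y (a y m) = 0) {N : Submodule ℂ X} (hN : ∀ y, ∀ m ∈ N, a y m ∈ N)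
    (h : N ≠ ⊥) : ∃ m ∈ N, m ≠ 0 ∧ ∀ y, a y m = 0 := by
  let b := Module.finBasis ℂ Y
  have key : ∀ s : Finset (Fin (finrank ℂ Y)), ∃ m ∈ N, m ≠ 0 ∧ ∀ i ∈ s, a (b i) m = 0 := by
    intro s
    induction s using Finset.induction_on with
    | empty =>
      obtain ⟨m, hm, h0⟩ := (Submodule.ne_bot_iff N).1 h
      exact ⟨m, hm, h0, by simp⟩
    | insert j s _ ih =>
      obtain ⟨m, hm, h0, hs⟩ := ih
      by_cases hj : a (b j) m = 0
      · exact ⟨m, hm, h0, by simpa [hj] using hs⟩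
      · refine ⟨a (b j) m, hN _ _ hm, hj, fun i hi => ?_⟩
        rcases Finset.mem_insert.1 hi with rfl | hi
        · exact ha _ _
        · rw [anticomm_of_sq_zero ha, hs i hi, map_zero, neg_zero]
  obtain ⟨m, hm, h0, hs⟩ := key Finset.univ
  refine ⟨m, hm, h0, fun y => ?_⟩
  rw [← b.sum_repr y, map_sum, LinearMap.sum_apply]
  exact Finset.sum_eq_zero fun i _ => by simp [hs i (Finset.mem_univ i)]

/-- For pairwise anticommuting square-zero operators, every finite-dimensional subspace lies in
a stable finite-dimensional subspace. -/
theorem exists_fg_stable [FiniteDimensional ℂ Y] {a : Y →ₗ[ℂ] X →ₗ[ℂ] X}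
    (ha : ∀ y m, a y (a y m) = 0) {D : Submodule ℂ X} (hD : D.FG) :
    ∃ D' : Submodule ℂ X, D'.FG ∧ D ≤ D' ∧ ∀ y, ∀ m ∈ D', a y m ∈ D' := by
  let b := Module.finBasis ℂ Y
  have key : ∀ s : Finset (Fin (finrank ℂ Y)), ∃ D' : Submodule ℂ X, D'.FG ∧ D ≤ D' ∧
      ∀ i ∈ s, ∀ m ∈ D', a (b i) m ∈ D' := by
    intro s
    induction s using Finset.induction_on with
    | empty => exact ⟨D, hD, le_rfl, by simp⟩
    | insert j s _ ih =>
      obtain ⟨D', hfg, hle, hs⟩ := ih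
      refine ⟨D' ⊔ D'.map (a (b j)), hfg.sup (hfg.map _), hle.trans le_sup_left, ?_⟩
      intro i hi m hm
      obtain ⟨u, hu, v, ⟨w, hw, rfl⟩, rfl⟩ := Submodule.mem_sup.1 hm
      rw [map_add]
      rcases Finset.mem_insert.1 hi with rfl | hi
      · rw [ha, add_zero]
        exact Submodule.mem_sup_right ⟨u, hu, rfl⟩
      · rw [anticomm_of_sq_zero ha (b i)]
        exact Submodule.add_mem_sup (hs i hi u hu)
          (Submodule.neg_mem _ ⟨a (b i) w, hs i hi w hw, rfl⟩)
  obtain ⟨D', hfg, hle, hs⟩ := key Finset.univ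
  refine ⟨D', hfg, hle, fun y m hm => ?_⟩
  rw [← b.sum_repr y, map_sum, LinearMap.sum_apply]
  refine Submodule.sum_mem _ fun i _ => ?_
  rw [map_smul]
  exact D'.smul_mem _ (hs i (Finset.mem_univ i) m hm)

/-- The joint image of pairwise anticommuting square-zero operators is a proper subspace. -/
theorem span_range_ne_top [FiniteDimensional ℂ Y] [Nontrivial X] {a : Y →ₗ[ℂ] X →ₗ[ℂ] X}
    (ha : ∀ y m, a y (a y m) = 0) :
    Submodule.span ℂ {m | ∃ y n, m = a y n} ≠ ⊤ := by
  obtain ⟨φ, -, h0, hφ⟩ := exists_common_null (X := Module.Dual ℂ X)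
    (a := Module.Dual.transpose ∘ₗ a) (N := ⊤)
    (fun y φ => LinearMap.ext fun m => by simp [Module.Dual.transpose_apply, ha])
    (fun _ _ _ => Submodule.mem_top) top_ne_bot
  intro h
  apply h0
  have : ⊤ ≤ LinearMap.ker φ := by
    rw [← h, Submodule.span_le]
    rintro _ ⟨y, n, rfl⟩
    exact LinearMap.congr_fun (hφ y) n
  exact LinearMap.ext fun m => this (Submodule.mem_top : m ∈ ⊤)

end SquareZero

namespace GLSA

variable (L : GLSA)

theorem exists_decomp (z : L.carrier) :
    ∃ h ∈ L.g0, ∃ y ∈ L.gneg, ∃ x ∈ L.gpos, z = h + y + x := by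
  obtain ⟨h, hh, o, ho, rfl⟩ := exists_add_of_isCompl L.oddCompl z
  obtain ⟨y, hy, x, hx, rfl⟩ := Submodule.mem_sup.1 ho
  exact ⟨h, hh, y, hy, x, hx, (add_assoc _ _ _).symm⟩

variable {L}

theorem gneg_le_odd : L.gneg ≤ L.odd := le_sup_left

theorem gpos_le_odd : L.gpos ≤ L.odd := le_sup_right

end GLSA

namespace SMod

variable {L : GLSA}

/-- The parity involution of a supermodule. -/
def par (M : SMod L) : M.carrier →ₗ[ℂ] M.carrier := parityOp M.grading

theorem par_par (M : SMod L) (m : M.carrier) : M.par (M.par m) = m := parityOp_parityOp _ m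

theorem act_par_even (M : SMod L) {x : L.carrier} (hx : x ∈ L.g0) (m : M.carrier) :
    M.act x (M.par m) = M.par (M.act x m) :=
  map_parityOp _ _ _ (M.act_e_ev x hx) (M.act_e_od x hx) m

theorem act_par_odd (M : SMod L) {x : L.carrier} (hx : x ∈ L.odd) (m : M.carrier) :
    M.act x (M.par m) = -M.par (M.act x m) :=
  map_parityOp_swap _ _ _ (M.act_o_ev x hx) (M.act_o_od x hx) m

theorem isSubmod_iff (M : SMod L) (N : Submodule ℂ M.carrier) :
    M.IsSubmod N ↔ (∀ x, ∀ m ∈ N, M.act x m ∈ N) ∧ ∀ m ∈ N, M.par m ∈ N :=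
  and_congr_right fun _ => le_inf_sup_inf_iff M.grading N

theorem isSubmod_of_pieces (M : SMod L) {N : Submodule ℂ M.carrier}
    (h0 : ∀ x ∈ L.g0, ∀ m ∈ N, M.act x m ∈ N) (hn : ∀ x ∈ L.gneg, ∀ m ∈ N, M.act x m ∈ N)
    (hp : ∀ x ∈ L.gpos, ∀ m ∈ N, M.act x m ∈ N) (hσ : ∀ m ∈ N, M.par m ∈ N) : M.IsSubmod N := by
  refine (M.isSubmod_iff N).2 ⟨fun z m hm => ?_, hσ⟩
  obtain ⟨h, hh, y, hy, x, hx, rfl⟩ := L.exists_decomp z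
  simp only [map_add, LinearMap.add_apply]
  exact N.add_mem (N.add_mem (h0 h hh m hm) (hn y hy m hm)) (hp x hx m hm)

theorem act_act_even (M : SMod L) {x : L.carrier} (hx : x ∈ L.g0) (y : L.carrier)
    (m : M.carrier) : M.act y (M.act x m) = M.act x (M.act y m) - M.act (L.bracket x y) m := by
  rw [M.act_br_e x y (Or.inl hx)]; abel

theorem act_act_odd (M : SMod L) {x y : L.carrier} (hx : x ∈ L.odd) (hy : y ∈ L.odd)
    (m : M.carrier) : M.act y (M.act x m) = M.act (L.bracket x y) m - M.act x (M.act y m) := by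
  rw [M.act_br_oo x hx y hy]; abel

/-- The action of `𝔤₋₁`. -/
def actNeg (M : SMod L) : L.gneg →ₗ[ℂ] M.carrier →ₗ[ℂ] M.carrier := M.act ∘ₗ L.gneg.subtype

/-- The action of `𝔤₁`. -/
def actPos (M : SMod L) : L.gpos →ₗ[ℂ] M.carrier →ₗ[ℂ] M.carrier := M.act ∘ₗ L.gpos.subtype

theorem actNeg_sq (M : SMod L) (y : L.gneg) (m : M.carrier) :
    M.actNeg y (M.actNeg y m) = 0 := by
  have := M.act_br_oo y (L.gneg_le_odd y.2) y (L.gneg_le_odd y.2) m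
  rw [L.br_nn y y.2 y y.2, map_zero, LinearMap.zero_apply, eq_comm, ← two_smul ℂ] at this
  exact (smul_eq_zero.1 this).resolve_left two_ne_zero

theorem actPos_sq (M : SMod L) (y : L.gpos) (m : M.carrier) :
    M.actPos y (M.actPos y m) = 0 := by
  have := M.act_br_oo y (L.gpos_le_odd y.2) y (L.gpos_le_odd y.2) m
  rw [L.br_pp y y.2 y y.2, map_zero, LinearMap.zero_apply, eq_comm, ← two_smul ℂ] at this
  exact (smul_eq_zero.1 this).resolve_left two_ne_zero

theorem exists_mem_invNeg [FiniteDimensional ℂ L.gneg] (M : SMod L) {N : Submodule ℂ M.carrier}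
    (hN : M.IsSubmod N) (h : N ≠ ⊥) : N ⊓ M.invNeg ≠ ⊥ := by
  obtain ⟨m, hm, h0, hy⟩ := exists_common_null M.actNeg_sq (N := N) (fun y m hm => hN.1 y m hm) h
  exact (Submodule.ne_bot_iff _).2 ⟨m, ⟨hm, fun x hx => hy ⟨x, hx⟩⟩, h0⟩

theorem par_mem_invNeg (M : SMod L) {m : M.carrier} (hm : m ∈ M.invNeg) :
    M.par m ∈ M.invNeg := fun x hx => by
  rw [M.act_par_odd (L.gneg_le_odd hx), hm x hx, map_zero, neg_zero]

theorem act_mem_invNeg (M : SMod L) {m : M.carrier} (hm : m ∈ M.invNeg) {x : L.carrier}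
    (hx : x ∈ L.g0) : M.act x m ∈ M.invNeg := fun y hy => by
  rw [M.act_act_even hx, hm y hy, hm _ (L.br_0n x hx y hy), map_zero, sub_zero]

/-- A supermodule built from an action together with a parity involution. -/
def ofInvolution {X : Type} [AddCommGroup X] [Module ℂ X] (act : L.carrier →ₗ[ℂ] X →ₗ[ℂ] X)
    (σ : X →ₗ[ℂ] X) (hσ : ∀ m, σ (σ m) = m)
    (he : ∀ x ∈ L.g0, ∀ m, act x (σ m) = σ (act x m))
    (ho : ∀ x ∈ L.odd, ∀ m, act x (σ m) = -σ (act x m))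
    (hbe : ∀ x y : L.carrier, (x ∈ L.g0 ∨ y ∈ L.g0) → ∀ m,
      act (L.bracket x y) m = act x (act y m) - act y (act x m))
    (hbo : ∀ x ∈ L.odd, ∀ y ∈ L.odd, ∀ m,
      act (L.bracket x y) m = act x (act y m) + act y (act x m)) : SMod L where
  carrier := X
  act := act
  ev := plusSpace σ
  od := minusSpace σ
  grading := isCompl_plusSpace_minusSpace hσ
  act_e_ev x hx m hm := by
    rw [mem_plusSpace] at *; rw [← he x hx, hm]
  act_e_od x hx m hm := by
    rw [mem_minusSpace] at *; rw [← he x hx, hm, map_neg]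
  act_o_ev x hx m hm := by
    rw [mem_plusSpace] at hm; rw [mem_minusSpace, ← neg_eq_iff_eq_neg, ← ho x hx, hm]
  act_o_od x hx m hm := by
    rw [mem_minusSpace] at hm
    rw [mem_plusSpace, ← neg_inj, ← ho x hx, hm, map_neg]
  act_br_e := hbe
  act_br_oo := hbo

/-- A graded submodule, viewed as a supermodule. -/
def sub (M : SMod L) (N : Submodule ℂ M.carrier) (hN : M.IsSubmod N) : SMod L :=
  ofInvolution (X := N)
    (LinearMap.mk₂ ℂ (fun x (m : N) => (⟨M.act x m, hN.1 x m m.2⟩ : N))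
      (fun _ _ _ => Subtype.ext (by simp)) (fun _ _ _ => Subtype.ext (by simp))
      (fun _ _ _ => Subtype.ext (by simp)) (fun _ _ _ => Subtype.ext (by simp)))
    (M.par.restrict ((M.isSubmod_iff N).1 hN).2)
    (fun m => Subtype.ext (M.par_par m))
    (fun _ hx m => Subtype.ext (M.act_par_even hx m))
    (fun _ hx m => Subtype.ext (M.act_par_odd hx m))
    (fun x y h m => Subtype.ext (M.act_br_e x y h m))
    (fun x hx y hy m => Subtype.ext (M.act_br_oo x hx y hy m))

/-- The inclusion of a graded submodule. -/
def subIncl (M : SMod L) (N : Submodule ℂ M.carrier) (hN : M.IsSubmod N) :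
    SHom (M.sub N hN) M where
  toLin := N.subtype
  map_ev _ hm := (parityOp_eq_self_iff M.grading).1 (congrArg Subtype.val (mem_plusSpace.1 hm))
  map_od _ hm := (parityOp_eq_neg_iff M.grading).1 (congrArg Subtype.val (mem_minusSpace.1 hm))
  equivar _ _ := rfl

/-- A nonzero submodule that is contained in every nonzero submodule. -/
def IsLeast (M : SMod L) (N : Submodule ℂ M.carrier) : Prop :=
  M.IsSubmod N ∧ N ≠ ⊥ ∧ ∀ N', M.IsSubmod N' → N' ≠ ⊥ → N ≤ N'

theorem IsLeast.isSimpleSub {M : SMod L} {N : Submodule ℂ M.carrier} (h : M.IsLeast N) :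
    M.IsSimpleSub N :=
  ⟨h.1, h.2.1, fun N' hN' hle =>
    or_iff_not_imp_left.2 fun h0 => le_antisymm hle (h.2.2 N' hN' h0)⟩

theorem IsLeast.socle_eq {M : SMod L} {N : Submodule ℂ M.carrier} (h : M.IsLeast N) :
    M.socle = N := by
  refine le_antisymm (sSup_le fun N' hN' => ?_) (le_sSup h.isSimpleSub)
  rcases hN'.2.2 N h.1 (h.2.2 N' hN'.1 hN'.2.1) with h' | h'
  · exact absurd h' h.2.1
  · exact h'.ge

theorem isSubmod_gen (M : SMod L) (S : Submodule ℂ M.carrier) : M.IsSubmod (M.gen S) := by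
  refine (M.isSubmod_iff _).2 ⟨fun x m hm => ?_, fun m hm => ?_⟩
  · exact Submodule.mem_sInf.2 fun N hN => hN.1.1 x m (Submodule.mem_sInf.1 hm N hN)
  · exact Submodule.mem_sInf.2 fun N hN =>
      ((M.isSubmod_iff N).1 hN.1).2 m (Submodule.mem_sInf.1 hm N hN)

theorem le_gen (M : SMod L) (S : Submodule ℂ M.carrier) : S ≤ M.gen S :=
  le_sInf fun _ hN => hN.2

theorem gen_le (M : SMod L) {S N : Submodule ℂ M.carrier} (hN : M.IsSubmod N) (h : S ≤ N) :
    M.gen S ≤ N := sInf_le ⟨hN, h⟩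

end SMod

namespace SHom

variable {L : GLSA} {M N P : SMod L}

theorem map_par (f : SHom M N) (m : M.carrier) : f.toLin (M.par m) = N.par (f.toLin m) :=
  map_parityOp _ _ _ f.map_ev f.map_od m

/-- Composition of homomorphisms. -/
def comp (g : SHom N P) (f : SHom M N) : SHom M P where
  toLin := g.toLin ∘ₗ f.toLin
  map_ev m hm := g.map_ev _ (f.map_ev m hm)
  map_od m hm := g.map_od _ (f.map_od m hm)
  equivar x m := by simp [f.equivar, g.equivar]

theorem isSubmod_map (f : SHom M N) {S : Submodule ℂ M.carrier} (hS : M.IsSubmod S) :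
    N.IsSubmod (S.map f.toLin) := by
  refine (N.isSubmod_iff _).2 ⟨?_, ?_⟩
  · rintro x _ ⟨m, hm, rfl⟩
    exact ⟨M.act x m, hS.1 x m hm, f.equivar x m⟩
  · rintro _ ⟨m, hm, rfl⟩
    exact ⟨M.par m, ((M.isSubmod_iff S).1 hS).2 m hm, f.map_par m⟩

theorem isSubmod_comap (f : SHom M N) {S : Submodule ℂ N.carrier} (hS : N.IsSubmod S) :
    M.IsSubmod (S.comap f.toLin) := by
  refine (M.isSubmod_iff _).2 ⟨fun x m hm => ?_, fun m hm => ?_⟩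
  · rw [Submodule.mem_comap, f.equivar]; exact hS.1 x _ hm
  · rw [Submodule.mem_comap, f.map_par]; exact ((N.isSubmod_iff S).1 hS).2 _ hm

theorem isSubmod_range (f : SHom M N) : N.IsSubmod (LinearMap.range f.toLin) := by
  rw [LinearMap.range_eq_map]
  exact f.isSubmod_map ((M.isSubmod_iff ⊤).2 (by simp))

theorem isSubmod_ker (f : SHom M N) : M.IsSubmod (LinearMap.ker f.toLin) := by
  rw [LinearMap.ker]
  exact f.isSubmod_comap ((N.isSubmod_iff ⊥).2 (by simp))

theorem isLeast_comap (f : SHom M N) (hf : Injective f.toLin) (h0 : (⊤ : Submodule ℂ M.carrier) ≠ ⊥)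
    {S : Submodule ℂ N.carrier} (hS : N.IsLeast S) : M.IsLeast (S.comap f.toLin) := by
  have hne : ∀ T : Submodule ℂ M.carrier, T ≠ ⊥ → T.map f.toLin ≠ ⊥ := fun T hT h =>
    hT (Submodule.map_injective_of_injective hf (h.trans (Submodule.map_bot _).symm))
  have hle : ∀ T, M.IsSubmod T → T ≠ ⊥ → S.comap f.toLin ≤ T := fun T hT hT0 m hm => by
    obtain ⟨t, ht, e⟩ := hS.2.2 _ (f.isSubmod_map hT) (hne T hT0) hm
    exact hf e ▸ ht
  refine ⟨f.isSubmod_comap hS.1, fun h => ?_, hle⟩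
  have htop : M.IsSubmod (⊤ : Submodule ℂ M.carrier) := (M.isSubmod_iff ⊤).2 (by simp)
  refine hS.2.1 (eq_bot_iff.2 fun s hs => ?_)
  obtain ⟨m, -, rfl⟩ := hS.2.2 _ (f.isSubmod_map htop) (hne ⊤ h0) hs
  have : m ∈ S.comap f.toLin := hs
  rw [h, Submodule.mem_bot] at this
  simp [this]

end SHom

section OperatorClosure

variable {X : Type} [AddCommGroup X] [Module ℂ X]

/-- The smallest subspace that contains `Z` and is stable under the operators in `T`. -/
def opClosure (T : Set (X →ₗ[ℂ] X)) (Z : Submodule ℂ X) : Submodule ℂ X :=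
  sInf {N | Z ≤ N ∧ ∀ f ∈ T, ∀ m ∈ N, f m ∈ N}

theorem le_opClosure (T : Set (X →ₗ[ℂ] X)) (Z : Submodule ℂ X) : Z ≤ opClosure T Z :=
  le_sInf fun _ h => h.1

theorem map_mem_opClosure {T : Set (X →ₗ[ℂ] X)} {Z : Submodule ℂ X} {f : X →ₗ[ℂ] X} (hf : f ∈ T)
    {m : X} (hm : m ∈ opClosure T Z) : f m ∈ opClosure T Z :=
  Submodule.mem_sInf.2 fun N hN => hN.2 f hf m (Submodule.mem_sInf.1 hm N hN)

theorem opClosure_le {T : Set (X →ₗ[ℂ] X)} {Z N : Submodule ℂ X} (hZ : Z ≤ N)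
    (hs : ∀ f ∈ T, ∀ m ∈ opClosure T Z, m ∈ N → f m ∈ N) : opClosure T Z ≤ N := by
  have : opClosure T Z ≤ N ⊓ opClosure T Z :=
    sInf_le ⟨le_inf hZ (le_opClosure T Z),
      fun f hf m hm => ⟨hs f hf m hm.2 hm.1, map_mem_opClosure hf hm.2⟩⟩
  exact this.trans inf_le_left

end OperatorClosure

namespace SMod

variable {L : GLSA}

/-- The vectors that every element of `A` moves into `N`. -/
def transporter (M : SMod L) (A : Submodule ℂ L.carrier) (N : Submodule ℂ M.carrier) :
    Submodule ℂ M.carrier := ⨅ x ∈ A, N.comap (M.act x)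

theorem mem_transporter {M : SMod L} {A : Submodule ℂ L.carrier} {N : Submodule ℂ M.carrier}
    {m : M.carrier} : m ∈ M.transporter A N ↔ ∀ x ∈ A, M.act x m ∈ N := by
  simp [transporter]

/-- The operators by which the elements of `A` act. -/
def ops (M : SMod L) (A : Submodule ℂ L.carrier) : Set (M.carrier →ₗ[ℂ] M.carrier) :=
  {f | ∃ x ∈ A, f = M.act x}

end SMod

namespace SHom

variable {L : GLSA} {M N : SMod L}

/-- A homomorphism from a linear map commuting with the action and the parity involution. -/
def ofPar (f : M.carrier →ₗ[ℂ] N.carrier) (hp : ∀ m, f (M.par m) = N.par (f m))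
    (hf : ∀ x m, f (M.act x m) = N.act x (f m)) : SHom M N where
  toLin := f
  map_ev m hm := by
    rw [← parityOp_eq_self_iff N.grading] at *
    rw [← parityOp_eq_self_iff M.grading] at hm
    exact (hp m).symm.trans (congrArg f hm)
  map_od m hm := by
    rw [← parityOp_eq_neg_iff N.grading] at *
    rw [← parityOp_eq_neg_iff M.grading] at hm
    exact (hp m).symm.trans ((congrArg f hm).trans (map_neg f m))
  equivar := hf

/-- The zero homomorphism. -/
def zero (M N : SMod L) : SHom M N := ofPar 0 (by simp) (by simp)

end SHom

namespace SMod0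

variable {L : GLSA}

/-- The parity involution of a supermodule. -/
def par (V : SMod0 L) : V.carrier →ₗ[ℂ] V.carrier := parityOp V.grading

theorem par_par (V : SMod0 L) (m : V.carrier) : V.par (V.par m) = m := parityOp_parityOp _ m

theorem act_par (V : SMod0 L) (x : L.g0) (m : V.carrier) :
    V.act x (V.par m) = V.par (V.act x m) :=
  map_parityOp _ _ _ (V.act_ev x) (V.act_od x) m

theorem isSubmod_iff (V : SMod0 L) (N : Submodule ℂ V.carrier) :
    V.IsSubmod N ↔ (∀ x, ∀ m ∈ N, V.act x m ∈ N) ∧ ∀ m ∈ N, V.par m ∈ N :=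
  and_congr_right fun _ => le_inf_sup_inf_iff V.grading N

end SMod0

namespace IsCoindPos

variable {L : GLSA} {V : SMod0 L} {C : SMod L} {ε : C.carrier →ₗ[ℂ] V.carrier}

theorem map_par (hC : IsCoindPos V C ε) (c : C.carrier) : ε (C.par c) = V.par (ε c) :=
  map_parityOp _ _ _ hC.map_ev hC.map_od c

theorem eq_bot_of_le_ker (hC : IsCoindPos V C ε) {N : Submodule ℂ C.carrier} (hN : C.IsSubmod N)
    (h : N ≤ LinearMap.ker ε) : N = ⊥ := by
  have := (hC.universal (C.sub N hN) 0 (by simp) (by simp) (by simp) (by simp)).unique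
    (y₁ := C.subIncl N hN) (y₂ := SHom.zero _ _) (fun m => h m.2) (fun m => by simp [SHom.zero, SHom.ofPar])
  refine eq_bot_iff.2 fun n hn => ?_
  exact LinearMap.congr_fun (congrArg SHom.toLin this) ⟨n, hn⟩

/-- The counit is injective on the `𝔤₋₁`-invariants. -/
theorem invNeg_inf_ker (hC : IsCoindPos V C ε) : C.invNeg ⊓ LinearMap.ker ε = ⊥ := by
  set Z := C.invNeg ⊓ LinearMap.ker ε with hZ
  set P := opClosure (C.ops L.gpos) Z
  have hpos : ∀ x ∈ L.gpos, ∀ m ∈ P, C.act x m ∈ P := fun x hx m hm =>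
    map_mem_opClosure (show C.act x ∈ C.ops L.gpos from ⟨x, hx, rfl⟩) hm
  have hZP : Z ≤ P := le_opClosure _ _
  have h0 : P ≤ C.transporter L.g0 P := by
    refine opClosure_le (fun z hz => SMod.mem_transporter.2 fun h hh => hZP (Submodule.mem_inf.2 ⟨?_, ?_⟩)) ?_
    · exact C.act_mem_invNeg hz.1 hh
    · have := hC.equivar ⟨h, hh⟩ z
      rw [show ε z = 0 from hz.2, map_zero] at this
      exact this
    · rintro _ ⟨x, hx, rfl⟩ m hm hm'
      rw [SMod.mem_transporter] at hm' ⊢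
      intro h hh
      have := C.act_br_e h x (Or.inl hh) m
      rw [eq_sub_iff_add_eq] at this
      rw [← this]
      exact P.add_mem (hpos _ (L.br_0p h hh x hx) m hm) (hpos x hx _ (hm' h hh))
  have hneg : P ≤ C.transporter L.gneg P := by
    refine opClosure_le (fun z hz => SMod.mem_transporter.2 fun y hy => ?_) ?_
    · rw [hz.1 y hy]; exact P.zero_mem
    · rintro _ ⟨x, hx, rfl⟩ m hm hm'
      rw [SMod.mem_transporter] at hm' ⊢
      intro y hy
      rw [C.act_act_odd (L.gpos_le_odd hx) (L.gneg_le_odd hy)]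
      exact P.sub_mem (SMod.mem_transporter.1 (h0 hm) _ (L.br_pn x hx y hy))
        (hpos x hx _ (hm' y hy))
  have hpar : P ≤ P.comap C.par := by
    refine opClosure_le (fun z hz => hZP (Submodule.mem_inf.2 ⟨C.par_mem_invNeg hz.1, ?_⟩)) ?_
    · rw [LinearMap.mem_ker, hC.map_par, show ε z = 0 from hz.2, map_zero]
    · rintro _ ⟨x, hx, rfl⟩ m - hm'
      rw [Submodule.mem_comap, ← neg_neg (C.par _), ← C.act_par_odd (L.gpos_le_odd hx)]
      exact P.neg_mem (hpos x hx _ hm')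
  have hker : P ≤ LinearMap.ker ε := by
    refine opClosure_le inf_le_right ?_
    rintro _ ⟨x, hx, rfl⟩ m - -
    exact hC.pos_zero x hx m
  have hP : P = ⊥ := hC.eq_bot_of_le_ker (C.isSubmod_of_pieces
    (fun x hx m hm => SMod.mem_transporter.1 (h0 hm) x hx)
    (fun x hx m hm => SMod.mem_transporter.1 (hneg hm) x hx) hpos (fun m hm => hpar hm)) hker
  exact eq_bot_iff.2 (hP ▸ hZP)

theorem eq_of_mem_invNeg (hC : IsCoindPos V C ε) {a b : C.carrier} (ha : a ∈ C.invNeg)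
    (hb : b ∈ C.invNeg) (h : ε a = ε b) : a = b := by
  have : a - b ∈ C.invNeg ⊓ LinearMap.ker ε :=
    Submodule.mem_inf.2 ⟨C.invNeg.sub_mem ha hb, by rw [LinearMap.mem_ker, map_sub, h, sub_self]⟩
  rw [hC.invNeg_inf_ker, Submodule.mem_bot, sub_eq_zero] at this
  exact this

theorem exists_mem_inf_invNeg [FiniteDimensional ℂ L.gneg] (hC : IsCoindPos V C ε)
    (hV : V.IsSimple) {N : Submodule ℂ C.carrier} (hN : C.IsSubmod N) (h : N ≠ ⊥) (v : V.carrier) :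
    ∃ n ∈ N, n ∈ C.invNeg ∧ ε n = v := by
  have hsub : V.IsSubmod ((N ⊓ C.invNeg).map ε) := by
    refine (V.isSubmod_iff _).2 ⟨?_, ?_⟩
    · rintro x _ ⟨n, hn, rfl⟩
      exact ⟨C.act x n, ⟨hN.1 x n hn.1, C.act_mem_invNeg hn.2 x.2⟩, hC.equivar x n⟩
    · rintro _ ⟨n, hn, rfl⟩
      exact ⟨C.par n, ⟨((C.isSubmod_iff N).1 hN).2 n hn.1, C.par_mem_invNeg hn.2⟩, hC.map_par n⟩
  have htop : (N ⊓ C.invNeg).map ε = ⊤ := by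
    refine (hV.2 _ hsub).resolve_left fun h0 => ?_
    obtain ⟨n, hn, hn0⟩ := (Submodule.ne_bot_iff _).1 (C.exists_mem_invNeg hN h)
    refine hn0 (hC.eq_of_mem_invNeg hn.2 C.invNeg.zero_mem ?_)
    have : ε n ∈ (N ⊓ C.invNeg).map ε := ⟨n, hn, rfl⟩
    rw [h0, Submodule.mem_bot] at this
    rw [this, map_zero]
  obtain ⟨n, hn, e⟩ : v ∈ (N ⊓ C.invNeg).map ε := htop ▸ Submodule.mem_top
  exact ⟨n, hn.1, hn.2, e⟩

theorem isLeast_gen_invNeg [FiniteDimensional ℂ L.gneg] (hC : IsCoindPos V C ε)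
    (hV : V.IsSimple) (h0 : (⊤ : Submodule ℂ C.carrier) ≠ ⊥) : C.IsLeast (C.gen C.invNeg) := by
  refine ⟨C.isSubmod_gen _, fun h => ?_, fun N hN hN0 => C.gen_le hN fun c hc => ?_⟩
  · have := C.exists_mem_invNeg ((C.isSubmod_iff ⊤).2 (by simp)) h0
    rw [top_inf_eq] at this
    exact this (eq_bot_iff.2 (h ▸ C.le_gen _))
  · obtain ⟨n, hn, hn', e⟩ := hC.exists_mem_inf_invNeg hV hN hN0 (ε c)
    rwa [← hC.eq_of_mem_invNeg hn' hc e]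

/-- The counit identifies the `𝔤₋₁`-invariants of any nonzero submodule with `V`. -/
theorem bijective_counit_invNeg [FiniteDimensional ℂ L.gneg] (hC : IsCoindPos V C ε)
    (hV : V.IsSimple) {S : SMod L} (f : SHom S C) (hf : Injective f.toLin)
    (h0 : LinearMap.range f.toLin ≠ ⊥) :
    Bijective ((ε ∘ₗ f.toLin).domRestrict S.invNeg) := by
  have hinv : ∀ s ∈ S.invNeg, f.toLin s ∈ C.invNeg := fun s hs x hx => by
    rw [← f.equivar, hs x hx, map_zero]
  refine ⟨fun a b hab => ?_, fun v => ?_⟩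
  · exact Subtype.ext (hf (hC.eq_of_mem_invNeg (hinv a a.2) (hinv b b.2) hab))
  · obtain ⟨_, ⟨s, rfl⟩, hs, e⟩ := hC.exists_mem_inf_invNeg hV f.isSubmod_range h0 v
    refine ⟨⟨s, fun x hx => hf ?_⟩, e⟩
    rw [f.equivar, map_zero]
    exact hs x hx

end IsCoindPos

/-- Two coinduced modules of simple modules with a common nonzero submodule come from isomorphic
modules. -/
theorem sIso0_of_common_submodule {L : GLSA} [FiniteDimensional ℂ L.gneg] {V V' : SMod0 L}
    (hV : V.IsSimple) (hV' : V'.IsSimple) {C C' S : SMod L} {ε : C.carrier →ₗ[ℂ] V.carrier}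
    {ε' : C'.carrier →ₗ[ℂ] V'.carrier} (hC : IsCoindPos V C ε) (hC' : IsCoindPos V' C' ε')
    (f : SHom S C) (hf : Injective f.toLin) (f' : SHom S C') (hf' : Injective f'.toLin)
    (h0 : LinearMap.range f.toLin ≠ ⊥) (h0' : LinearMap.range f'.toLin ≠ ⊥) : SIso0 V V' := by
  let e := LinearEquiv.ofBijective _ (hC.bijective_counit_invNeg hV f hf h0)
  let e' := LinearEquiv.ofBijective _ (hC'.bijective_counit_invNeg hV' f' hf' h0')
  have he : ∀ s : S.invNeg, e s = ε (f.toLin s) := fun _ => rfl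
  have he' : ∀ s : S.invNeg, e' s = ε' (f'.toLin s) := fun _ => rfl
  have hpar : ∀ v, (e.symm.trans e') (V.par v) = V'.par ((e.symm.trans e') v) := by
    intro v
    obtain ⟨s, rfl⟩ := e.surjective v
    have : V.par (e s) = e ⟨S.par s, S.par_mem_invNeg s.2⟩ := by
      simp only [he, f.map_par, hC.map_par]
    rw [this]
    simp only [LinearEquiv.trans_apply, LinearEquiv.symm_apply_apply, he', f'.map_par, hC'.map_par]
  refine ⟨e.symm.trans e', fun v hv => ?_, fun v hv => ?_, fun x v => ?_⟩
  · rw [← parityOp_eq_self_iff V'.grading]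
    exact (hpar v).symm.trans (congrArg _ (parityOp_left V.grading hv))
  · rw [← parityOp_eq_neg_iff V'.grading]
    exact (hpar v).symm.trans ((congrArg _ (parityOp_right V.grading hv)).trans (map_neg _ _))
  · obtain ⟨s, rfl⟩ := e.surjective v
    have : V.act x (e s) = e ⟨S.act x s, S.act_mem_invNeg s.2 x.2⟩ := by
      simp only [he, f.equivar, hC.equivar]
    rw [this]
    simp only [LinearEquiv.trans_apply, LinearEquiv.symm_apply_apply, he', f'.equivar, hC'.equivar]

namespace GLSA

variable (L : GLSA)

/-- The defining relations of the universal enveloping superalgebra. -/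
inductive EnvRel : TensorAlgebra ℂ L.carrier → TensorAlgebra ℂ L.carrier → Prop
  | even (x y : L.carrier) (h : x ∈ L.g0 ∨ y ∈ L.g0) :
      EnvRel (TensorAlgebra.ι ℂ (L.bracket x y))
        (TensorAlgebra.ι ℂ x * TensorAlgebra.ι ℂ y - TensorAlgebra.ι ℂ y * TensorAlgebra.ι ℂ x)
  | odd (x y : L.carrier) (hx : x ∈ L.odd) (hy : y ∈ L.odd) :
      EnvRel (TensorAlgebra.ι ℂ (L.bracket x y))
        (TensorAlgebra.ι ℂ x * TensorAlgebra.ι ℂ y + TensorAlgebra.ι ℂ y * TensorAlgebra.ι ℂ x)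

/-- The universal enveloping superalgebra. -/
def Env : Type := RingQuot L.EnvRel

instance : Ring L.Env := inferInstanceAs (Ring (RingQuot L.EnvRel))

instance : Algebra ℂ L.Env := inferInstanceAs (Algebra ℂ (RingQuot L.EnvRel))

/-- The projection from the tensor algebra. -/
def envMk : TensorAlgebra ℂ L.carrier →ₐ[ℂ] L.Env := RingQuot.mkAlgHom ℂ L.EnvRel

/-- The canonical map into the enveloping superalgebra. -/
def envι : L.carrier →ₗ[ℂ] L.Env :=
  L.envMk.toLinearMap ∘ₗ TensorAlgebra.ι ℂ

theorem envι_bracket_even (x y : L.carrier) (h : x ∈ L.g0 ∨ y ∈ L.g0) :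
    L.envι (L.bracket x y) = L.envι x * L.envι y - L.envι y * L.envι x := by
  have : L.envMk _ = L.envMk _ := RingQuot.mkAlgHom_rel ℂ (EnvRel.even x y h)
  rw [map_sub, map_mul, map_mul] at this
  exact this

theorem envι_bracket_odd (x y : L.carrier) (hx : x ∈ L.odd) (hy : y ∈ L.odd) :
    L.envι (L.bracket x y) = L.envι x * L.envι y + L.envι y * L.envι x := by
  have : L.envMk _ = L.envMk _ := RingQuot.mkAlgHom_rel ℂ (EnvRel.odd x y hx hy)
  rw [map_add, map_mul, map_mul] at this
  exact this

variable {L}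

theorem env_induction {P : L.Env → Prop} (halg : ∀ r : ℂ, P (algebraMap ℂ L.Env r))
    (hι : ∀ x, P (L.envι x)) (hmul : ∀ a b, P a → P b → P (a * b))
    (hadd : ∀ a b, P a → P b → P (a + b)) (u : L.Env) : P u := by
  obtain ⟨t, rfl⟩ : ∃ t, L.envMk t = u := RingQuot.mkAlgHom_surjective ℂ L.EnvRel u
  induction t using TensorAlgebra.induction with
  | algebraMap r => rw [AlgHom.commutes]; exact halg r
  | ι x => exact hι x
  | mul a b ha hb => rw [map_mul]; exact hmul _ _ ha hb
  | add a b ha hb => rw [map_add]; exact hadd _ _ ha hb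

section Lift

variable {A : Type} [Ring A] [Algebra ℂ A] (f : L.carrier →ₗ[ℂ] A)
    (he : ∀ x y : L.carrier, (x ∈ L.g0 ∨ y ∈ L.g0) → f (L.bracket x y) = f x * f y - f y * f x)
    (ho : ∀ x ∈ L.odd, ∀ y ∈ L.odd, f (L.bracket x y) = f x * f y + f y * f x)

/-- The universal property of the enveloping superalgebra. -/
def envLift : L.Env →ₐ[ℂ] A :=
  RingQuot.liftAlgHom ℂ ⟨TensorAlgebra.lift ℂ f, by
    rintro _ _ (⟨x, y, h⟩ | ⟨x, y, hx, hy⟩)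
    · simpa using he x y h
    · simpa using ho x hx y hy⟩

theorem envLift_ι (x : L.carrier) : envLift f he ho (L.envι x) = f x :=
  (RingQuot.liftAlgHom_mkAlgHom_apply ℂ _ _ _).trans (TensorAlgebra.lift_ι_apply _ _)

end Lift

variable (L) in
/-- The parity involution of a Lie superalgebra. -/
def par : L.carrier →ₗ[ℂ] L.carrier := parityOp L.oddCompl

theorem par_even {x : L.carrier} (hx : x ∈ L.g0) : L.par x = x := parityOp_left L.oddCompl hx

theorem par_odd {x : L.carrier} (hx : x ∈ L.odd) : L.par x = -x := parityOp_right L.oddCompl hx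

theorem bracket_mem_odd {x y : L.carrier} (hx : x ∈ L.g0) (hy : y ∈ L.odd) :
    L.bracket x y ∈ L.odd := by
  obtain ⟨a, ha, b, hb, rfl⟩ := Submodule.mem_sup.1 hy
  rw [map_add]
  exact Submodule.add_mem_sup (L.br_0n x hx a ha) (L.br_0p x hx b hb)

theorem bracket_odd_odd {x y : L.carrier} (hx : x ∈ L.odd) (hy : y ∈ L.odd) :
    L.bracket x y ∈ L.g0 := by
  obtain ⟨a, ha, b, hb, rfl⟩ := Submodule.mem_sup.1 hy
  obtain ⟨c, hc, d, hd, rfl⟩ := Submodule.mem_sup.1 hx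
  simp only [map_add, LinearMap.add_apply, L.br_nn c hc a ha, L.br_pp d hd b hb, zero_add,
    add_zero]
  rw [L.skew_oo c (L.gneg_le_odd hc) b (L.gpos_le_odd hb)]
  exact L.g0.add_mem (L.br_pn d hd a ha) (L.br_pn b hb c hc)

theorem par_bracket_even {x : L.carrier} (hx : x ∈ L.g0) (y : L.carrier) :
    L.par (L.bracket x y) = L.bracket x (L.par y) :=
  (map_parityOp L.oddCompl L.oddCompl (L.bracket x) (L.br_00 x hx)
    (fun _ hm => bracket_mem_odd hx hm) y).symm

variable (L) in
/-- The parity automorphism of the enveloping superalgebra. -/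
def envPar : L.Env →ₐ[ℂ] L.Env :=
  envLift (L.envι ∘ₗ L.par)
    (by
      intro x y h
      simp only [LinearMap.comp_apply]
      rcases h with h | h
      · rw [par_bracket_even h, envι_bracket_even _ _ _ (Or.inl h), par_even h]
      · rw [← neg_inj, ← map_neg, ← map_neg, ← L.skew_e y h x, par_bracket_even h,
          envι_bracket_even _ _ _ (Or.inl h), par_even h, neg_sub])
    (by
      intro x hx y hy
      simp only [LinearMap.comp_apply]
      rw [par_even (bracket_odd_odd hx hy), par_odd hx, par_odd hy, envι_bracket_odd _ _ _ hx hy]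
      simp)

theorem envPar_ι (x : L.carrier) : L.envPar (L.envι x) = L.envι (L.par x) := envLift_ι _ _ _ x

theorem envPar_envPar (u : L.Env) : L.envPar (L.envPar u) = u := by
  induction u using env_induction with
  | halg r => simp
  | hι x => rw [envPar_ι, envPar_ι, show L.par (L.par x) = x from parityOp_parityOp _ x]
  | hmul a b ha hb => rw [map_mul, map_mul, ha, hb]
  | hadd a b ha hb => rw [map_add, map_add, ha, hb]

end GLSA

namespace SMod

variable {L : GLSA}

/-- The action of the enveloping superalgebra on a supermodule. -/
def rep (M : SMod L) : L.Env →ₐ[ℂ] Module.End ℂ M.carrier :=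
  GLSA.envLift (A := Module.End ℂ M.carrier) M.act
    (fun x y h => LinearMap.ext fun m => M.act_br_e x y h m)
    (fun x hx y hy => LinearMap.ext fun m => M.act_br_oo x hx y hy m)

theorem rep_ι (M : SMod L) (x : L.carrier) : M.rep (L.envι x) = M.act x :=
  GLSA.envLift_ι _ _ _ x

theorem rep_envPar_par (M : SMod L) (u : L.Env) :
    ∀ m, M.rep (L.envPar u) (M.par m) = M.par (M.rep u m) := by
  induction u using GLSA.env_induction with
  | halg r => intro m; simp [Module.algebraMap_end_apply]
  | hι x =>
    intro m
    rw [GLSA.envPar_ι, rep_ι, rep_ι]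
    obtain ⟨h, hh, o, ho, rfl⟩ := exists_add_of_isCompl L.oddCompl x
    rw [map_add, GLSA.par_even hh, GLSA.par_odd ho]
    simp [M.act_par_even hh, M.act_par_odd ho]
  | hmul a b ha hb => intro m; simp [ha, hb]
  | hadd a b ha hb => intro m; simp [ha, hb]

end SMod

theorem SHom.map_rep {L : GLSA} {M N : SMod L} (f : SHom M N) (u : L.Env) :
    ∀ m, f.toLin (M.rep u m) = N.rep u (f.toLin m) := by
  induction u using GLSA.env_induction with
  | halg r => intro m; simp [Module.algebraMap_end_apply]
  | hι x => intro m; rw [SMod.rep_ι, SMod.rep_ι, f.equivar]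
  | hmul a b ha hb => intro m; simp [ha, hb]
  | hadd a b ha hb => intro m; simp [ha, hb]

namespace SMod0

variable {L : GLSA}

/-- The space `Hom_{U(𝔤≥0)}(U(𝔤), V)`. -/
def coindSpace (V : SMod0 L) : Submodule ℂ (L.Env →ₗ[ℂ] V.carrier) where
  carrier := {f | (∀ (h : L.g0) (u : L.Env), f (L.envι h * u) = V.act h (f u)) ∧
    ∀ x ∈ L.gpos, ∀ u : L.Env, f (L.envι x * u) = 0}
  add_mem' ha hb := ⟨fun h u => by simp [ha.1, hb.1], fun x hx u => by simp [ha.2 x hx, hb.2 x hx]⟩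
  zero_mem' := ⟨by simp, by simp⟩
  smul_mem' c a ha := ⟨fun h u => by simp [ha.1], fun x hx u => by simp [ha.2 x hx]⟩

/-- The action of `𝔤` on the coinduced module, by right multiplication in the argument. -/
def coindAct (V : SMod0 L) : L.carrier →ₗ[ℂ] V.coindSpace →ₗ[ℂ] V.coindSpace :=
  LinearMap.mk₂ ℂ (fun z f => ⟨f.1 ∘ₗ LinearMap.mulRight ℂ (L.envι z),
      fun h u => by simp [mul_assoc, f.2.1], fun x hx u => by simp [mul_assoc, f.2.2 x hx]⟩)
    (fun _ _ _ => Subtype.ext (LinearMap.ext fun _ => by simp [mul_add]))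
    (fun _ _ _ => Subtype.ext (LinearMap.ext fun _ => by simp))
    (fun _ _ _ => Subtype.ext (LinearMap.ext fun _ => by simp))
    (fun _ _ _ => Subtype.ext (LinearMap.ext fun _ => by simp))

theorem coindAct_apply (V : SMod0 L) (z : L.carrier) (f : V.coindSpace) (u : L.Env) :
    (V.coindAct z f).1 u = f.1 (u * L.envι z) := rfl

/-- The parity involution of the coinduced module. -/
def coindPar (V : SMod0 L) : V.coindSpace →ₗ[ℂ] V.coindSpace where
  toFun f := ⟨V.par ∘ₗ f.1 ∘ₗ L.envPar.toLinearMap,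
    fun h u => by simp [GLSA.envPar_ι, GLSA.par_even h.2, f.2.1, V.act_par],
    fun x hx u => by simp [GLSA.envPar_ι, GLSA.par_odd (L.gpos_le_odd hx), f.2.2 x hx]⟩
  map_add' _ _ := Subtype.ext (LinearMap.ext fun _ => by simp)
  map_smul' _ _ := Subtype.ext (LinearMap.ext fun _ => by simp)

theorem coindPar_apply (V : SMod0 L) (f : V.coindSpace) (u : L.Env) :
    (V.coindPar f).1 u = V.par (f.1 (L.envPar u)) := rfl

theorem coindPar_coindPar (V : SMod0 L) (f : V.coindSpace) : V.coindPar (V.coindPar f) = f :=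
  Subtype.ext (LinearMap.ext fun u => by
    rw [coindPar_apply, coindPar_apply, V.par_par, GLSA.envPar_envPar])

/-- The coinduced module `Coind_{𝔤≥0}^𝔤 V`. -/
def coind (V : SMod0 L) : SMod L :=
  SMod.ofInvolution V.coindAct V.coindPar V.coindPar_coindPar
    (fun x hx f => Subtype.ext (LinearMap.ext fun u => by
      simp only [coindAct_apply, coindPar_apply, map_mul, GLSA.envPar_ι, GLSA.par_even hx]))
    (fun x hx f => Subtype.ext (LinearMap.ext fun u => by
      simp only [Submodule.coe_neg, LinearMap.neg_apply, coindAct_apply, coindPar_apply, map_mul,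
        GLSA.envPar_ι, GLSA.par_odd hx, map_neg, mul_neg]))
    (fun x y h f => Subtype.ext (LinearMap.ext fun u => by
      simp only [Submodule.coe_sub, LinearMap.sub_apply, coindAct_apply,
        L.envι_bracket_even x y h, mul_sub, map_sub, mul_assoc]))
    (fun x hx y hy f => Subtype.ext (LinearMap.ext fun u => by
      simp only [Submodule.coe_add, LinearMap.add_apply, coindAct_apply,
        L.envι_bracket_odd x y hx hy, mul_add, map_add, mul_assoc]))

theorem coind_par (V : SMod0 L) (f : V.coindSpace) : V.coind.par f = V.coindPar f :=
  parityOp_plusSpace_minusSpace V.coindPar_coindPar f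

/-- Evaluation at `1`. -/
def coindCounit (V : SMod0 L) : V.coind.carrier →ₗ[ℂ] V.carrier :=
  LinearMap.applyₗ (1 : L.Env) ∘ₗ V.coindSpace.subtype

theorem coindCounit_rep (V : SMod0 L) (u : L.Env) : ∀ (f : V.coindSpace) (v : L.Env),
    Subtype.val (p := (· ∈ V.coindSpace)) (V.coind.rep u f) v = f.1 (v * u) := by
  induction u using GLSA.env_induction with
  | halg r =>
    intro f v
    rw [AlgHom.commutes, ← Algebra.commutes, ← Algebra.smul_def, map_smul]
    rfl
  | hι x => intro f v; rw [SMod.rep_ι]; rfl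
  | hmul a b ha hb =>
    intro f v
    rw [map_mul, ← mul_assoc, ← hb]
    exact ha (V.coind.rep b f) v
  | hadd a b ha hb =>
    intro f v
    rw [mul_add, map_add f.1, ← ha, ← hb, map_add]
    rfl

theorem isCoindPos_coind (V : SMod0 L) : IsCoindPos V V.coind V.coindCounit where
  map_ev c hc := by
    rw [← parityOp_eq_self_iff V.grading]
    have h : V.coindPar c = c := mem_plusSpace.1 hc
    have := V.coindPar_apply c 1
    rw [h, map_one L.envPar] at this
    exact this.symm
  map_od c hc := by
    rw [← parityOp_eq_neg_iff V.grading]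
    have h : V.coindPar c = -c := mem_minusSpace.1 hc
    have := V.coindPar_apply c 1
    rw [h, map_one L.envPar] at this
    exact this.symm
  equivar x c := by
    have := c.2.1 x 1
    rw [mul_one] at this
    exact (congrArg c.1 (one_mul _)).trans this
  pos_zero x hx c := by
    have := c.2.2 x hx 1
    rw [mul_one] at this
    exact (congrArg c.1 (one_mul _)).trans this
  universal M ψ hev hod h0 hp := by
    have hpar : ∀ m, ψ (M.par m) = V.par (ψ m) := map_parityOp _ _ _ hev hod
    let Φ : M.carrier →ₗ[ℂ] V.coindSpace :=
      { toFun := fun m => ⟨ψ ∘ₗ LinearMap.applyₗ m ∘ₗ M.rep.toLinearMap,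
          fun h u => by simp [SMod.rep_ι, h0], fun x hx u => by simp [SMod.rep_ι, hp x hx]⟩
        map_add' := fun _ _ => Subtype.ext (LinearMap.ext fun _ => by simp)
        map_smul' := fun _ _ => Subtype.ext (LinearMap.ext fun _ => by simp) }
    have hΦ : ∀ m u, (Φ m).1 u = ψ (M.rep u m) := fun _ _ => rfl
    refine ⟨SHom.ofPar (N := V.coind) Φ (fun m => ?_) (fun x m => ?_), fun m => ?_, fun Ψ hΨ => ?_⟩
    · refine Eq.trans (Subtype.ext (LinearMap.ext fun u => ?_)) (V.coind_par (Φ m)).symm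
      change ψ (M.rep u (M.par m)) = V.par (ψ (M.rep (L.envPar u) m))
      rw [← hpar, ← M.rep_envPar_par, GLSA.envPar_envPar]
    · refine Subtype.ext (LinearMap.ext fun u => ?_)
      refine Eq.trans ?_ (V.coindAct_apply x (Φ m) u).symm
      change ψ (M.rep u (M.act x m)) = ψ (M.rep (u * L.envι x) m)
      rw [map_mul, SMod.rep_ι, Module.End.mul_apply]
    · change ψ (M.rep 1 m) = ψ m
      rw [map_one, Module.End.one_apply]
    · have key : Ψ.toLin = Φ := by
        refine LinearMap.ext fun m => Subtype.ext (LinearMap.ext fun u => ?_)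
        refine Eq.trans ?_ ((hΨ (M.rep u m)).symm.trans
          ((congrArg V.coindCounit (Ψ.map_rep u m)).trans
            (V.coindCounit_rep u (Ψ.toLin m) 1))).symm
        rw [one_mul]
      obtain ⟨f, h1, h2, h3⟩ := Ψ
      obtain rfl : f = Φ := key
      rfl

end SMod0

/-- The free module `Λ(Y) ⊗ W` over the exterior algebra of `Y`. -/
def ExtMod (Y W : Type) [AddCommGroup Y] [Module ℂ Y] [AddCommGroup W] [Module ℂ W] : Type :=
  TensorProduct ℂ (ExteriorAlgebra ℂ Y) W

namespace ExtMod

variable {Y W N : Type} [AddCommGroup Y] [Module ℂ Y] [AddCommGroup W] [Module ℂ W]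
  [AddCommGroup N] [Module ℂ N]

instance : AddCommGroup (ExtMod Y W) :=
  inferInstanceAs (AddCommGroup (TensorProduct ℂ (ExteriorAlgebra ℂ Y) W))

instance : Module ℂ (ExtMod Y W) :=
  inferInstanceAs (Module ℂ (TensorProduct ℂ (ExteriorAlgebra ℂ Y) W))

variable (Y W) in
/-- The canonical bilinear map into `Λ(Y) ⊗ W`. -/
def tmul : ExteriorAlgebra ℂ Y →ₗ[ℂ] W →ₗ[ℂ] ExtMod Y W :=
  TensorProduct.mk ℂ (ExteriorAlgebra ℂ Y) W

theorem tmul_induction {P : ExtMod Y W → Prop} (htmul : ∀ u w, P (tmul Y W u w))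
    (hadd : ∀ a b, P a → P b → P (a + b)) (m : ExtMod Y W) : P m :=
  TensorProduct.induction_on (motive := P) m
    (by
      have := htmul 0 0
      rwa [map_zero] at this)
    htmul hadd

/-- The universal property of `Λ(Y) ⊗ W` as a vector space. -/
def lift (f : ExteriorAlgebra ℂ Y →ₗ[ℂ] W →ₗ[ℂ] N) : ExtMod Y W →ₗ[ℂ] N :=
  TensorProduct.lift f

theorem lift_tmul (f : ExteriorAlgebra ℂ Y →ₗ[ℂ] W →ₗ[ℂ] N) (u : ExteriorAlgebra ℂ Y) (w : W) :
    lift f (tmul Y W u w) = f u w := TensorProduct.lift.tmul u w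

variable (Y) in
/-- The inclusion of the degree zero part. -/
def emb : W →ₗ[ℂ] ExtMod Y W := tmul Y W 1

variable (W) in
/-- Left multiplication by elements of the exterior algebra. -/
def mul : ExteriorAlgebra ℂ Y →ₗ[ℂ] ExtMod Y W →ₗ[ℂ] ExtMod Y W where
  toFun u := lift (tmul Y W ∘ₗ LinearMap.mulLeft ℂ u)
  map_add' u v := LinearMap.ext fun m => by
    induction m using tmul_induction with
    | htmul a w => simp [lift_tmul, add_mul]
    | hadd a b ha hb => rw [map_add, map_add, ha, hb]
  map_smul' c u := LinearMap.ext fun m => by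
    induction m using tmul_induction with
    | htmul a w => simp [lift_tmul]
    | hadd a b ha hb => rw [map_add, map_add, ha, hb]

variable (W) in
/-- Left multiplication by elements of degree one. -/
def lmul : Y →ₗ[ℂ] ExtMod Y W →ₗ[ℂ] ExtMod Y W := mul W ∘ₗ ExteriorAlgebra.ι ℂ

theorem mul_tmul (u v : ExteriorAlgebra ℂ Y) (w : W) :
    mul W u (tmul Y W v w) = tmul Y W (u * v) w := lift_tmul ..

theorem lmul_tmul (y : Y) (u : ExteriorAlgebra ℂ Y) (w : W) :
    lmul W y (tmul Y W u w) = tmul Y W (ExteriorAlgebra.ι ℂ y * u) w := mul_tmul ..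

theorem mul_one_left (m : ExtMod Y W) : mul W 1 m = m := by
  induction m using tmul_induction with
  | htmul a w => rw [mul_tmul, one_mul]
  | hadd a b ha hb => rw [map_add, ha, hb]

theorem mul_mul (u v : ExteriorAlgebra ℂ Y) (m : ExtMod Y W) :
    mul W u (mul W v m) = mul W (u * v) m := by
  induction m using tmul_induction with
  | htmul a w => rw [mul_tmul, mul_tmul, mul_tmul, mul_assoc]
  | hadd a b ha hb => simp only [map_add, ha, hb]

theorem lmul_lmul (y : Y) (m : ExtMod Y W) : lmul W y (lmul W y m) = 0 := by
  change mul W _ (mul W _ m) = 0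
  rw [mul_mul, ExteriorAlgebra.ι_sq_zero, map_zero, LinearMap.zero_apply]

theorem induction {P : ExtMod Y W → Prop} (hemb : ∀ w, P (emb Y w))
    (hadd : ∀ a b, P a → P b → P (a + b)) (hmul : ∀ y a, P a → P (lmul W y a))
    (m : ExtMod Y W) : P m := by
  induction m using tmul_induction with
  | hadd a b ha hb => exact hadd a b ha hb
  | htmul u w =>
    induction u using CliffordAlgebra.left_induction with
    | algebraMap r =>
      have := hemb (r • w)
      rw [map_smul, emb, ← LinearMap.smul_apply, ← map_smul, ← Algebra.algebraMap_eq_smul_one]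
        at this
      exact this
    | add a b ha hb => rw [map_add, LinearMap.add_apply]; exact hadd _ _ ha hb
    | ι_mul u y h =>
      have := hmul y _ h
      rw [lmul_tmul] at this
      exact this

section Recursion

variable (g : W →ₗ[ℂ] N) (f₁ : Y →ₗ[ℂ] ExtMod Y W →ₗ[ℂ] N) (f₂ : Y →ₗ[ℂ] N →ₗ[ℂ] N)

/-- The step of the recursion in `ExtMod.recHom`, with values in `Hom(W, N)`. -/
def recStep : Y →ₗ[ℂ] ExteriorAlgebra ℂ Y × (W →ₗ[ℂ] N) →ₗ[ℂ] (W →ₗ[ℂ] N) :=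
  LinearMap.mk₂ ℂ (fun y p => f₁ y ∘ₗ tmul Y W p.1 + f₂ y ∘ₗ p.2)
    (fun _ _ _ => LinearMap.ext fun _ => by simp; abel)
    (fun _ _ _ => LinearMap.ext fun _ => by simp)
    (fun _ _ _ => LinearMap.ext fun _ => by simp; abel)
    (fun _ _ _ => LinearMap.ext fun _ => by simp)

theorem recStep_sq (h₁ : ∀ y m, f₁ y (lmul W y m) + f₂ y (f₁ y m) = 0)
    (h₂ : ∀ y n, f₂ y (f₂ y n) = 0) (y : Y) (u : ExteriorAlgebra ℂ Y) (φ : W →ₗ[ℂ] N) :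
    recStep f₁ f₂ y (ExteriorAlgebra.ι ℂ y * u, recStep f₁ f₂ y (u, φ)) =
      (0 : QuadraticForm ℂ Y) y • φ := by
  refine LinearMap.ext fun w => ?_
  have := h₁ y (tmul Y W u w)
  rw [lmul_tmul] at this
  simp [recStep, h₂, this]

variable (h₁ : ∀ y m, f₁ y (lmul W y m) + f₂ y (f₁ y m) = 0) (h₂ : ∀ y n, f₂ y (f₂ y n) = 0)

/-- A linear map out of `Λ(Y) ⊗ W` defined by recursion on the degree. -/
def recHom : ExtMod Y W →ₗ[ℂ] N :=
  lift (CliffordAlgebra.foldr' (0 : QuadraticForm ℂ Y) (recStep f₁ f₂)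
    (recStep_sq f₁ f₂ h₁ h₂) g)

theorem recHom_emb (w : W) : recHom g f₁ f₂ h₁ h₂ (emb Y w) = g w := by
  have := CliffordAlgebra.foldr'_algebraMap (0 : QuadraticForm ℂ Y) (recStep f₁ f₂)
    (recStep_sq f₁ f₂ h₁ h₂) g 1
  rw [map_one, one_smul] at this
  exact (lift_tmul _ _ _).trans (LinearMap.congr_fun this w)

theorem recHom_lmul (y : Y) (m : ExtMod Y W) : recHom g f₁ f₂ h₁ h₂ (lmul W y m) =
    f₁ y m + f₂ y (recHom g f₁ f₂ h₁ h₂ m) := by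
  induction m using tmul_induction with
  | hadd a b ha hb => simp only [map_add, ha, hb]; abel
  | htmul u w =>
    rw [lmul_tmul, recHom, lift_tmul, lift_tmul]
    exact LinearMap.congr_fun (CliffordAlgebra.foldr'_ι_mul (0 : QuadraticForm ℂ Y)
      (recStep f₁ f₂) (recStep_sq f₁ f₂ h₁ h₂) g y u) w

end Recursion

/-- The action of a functional on `Y` by contraction. -/
def contract (φ : Y →ₗ[ℂ] ℂ) : ExtMod Y W →ₗ[ℂ] ExtMod Y W :=
  recHom 0 (φ.smulRight LinearMap.id) (-lmul W) (fun y m => by simp)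
    (fun y m => by simp [lmul_lmul])

theorem contract_lmul (φ : Y →ₗ[ℂ] ℂ) (y : Y) (m : ExtMod Y W) :
    contract φ (lmul W y m) = φ y • m - lmul W y (contract φ m) := by
  rw [contract, recHom_lmul]
  simp [sub_eq_add_neg]

/-- The grading involution. -/
def sign (σ : W →ₗ[ℂ] W) : ExtMod Y W →ₗ[ℂ] ExtMod Y W :=
  recHom (emb Y ∘ₗ σ) 0 (-lmul W) (fun y m => by simp) (fun y m => by simp [lmul_lmul])

theorem sign_emb (σ : W →ₗ[ℂ] W) (w : W) : sign σ (emb Y w) = emb Y (σ w) := recHom_emb ..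

theorem sign_lmul (σ : W →ₗ[ℂ] W) (y : Y) (m : ExtMod Y W) :
    sign σ (lmul W y m) = -lmul W y (sign σ m) := by
  rw [sign, recHom_lmul]
  simp

theorem sign_sign {σ : W →ₗ[ℂ] W} (hσ : ∀ w, σ (σ w) = w) (m : ExtMod Y W) :
    sign σ (sign σ m) = m := by
  induction m using induction with
  | hemb w => rw [sign_emb, sign_emb, hσ]
  | hadd a b ha hb => rw [map_add, map_add, ha, hb]
  | hmul y a ha => rw [sign_lmul, map_neg, sign_lmul, neg_neg, ha]

section Monomials

/-- The monomial `v₁ ∧ ⋯ ∧ vₖ ⊗ w`. -/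
def mono {k : ℕ} (v : Fin k → Y) (w : W) : ExtMod Y W := tmul Y W (ExteriorAlgebra.ιMulti ℂ k v) w

theorem emb_eq_mono (w : W) : emb Y w = mono ![] w := by
  rw [mono, ExteriorAlgebra.ιMulti_zero_apply]; rfl

theorem lmul_mono {k : ℕ} (y : Y) (v : Fin k → Y) (w : W) :
    lmul W y (mono v w) = mono (Matrix.vecCons y v) w := by
  rw [mono, mono, ExteriorAlgebra.ιMulti_succ_apply, lmul_tmul]
  simp

theorem mono_induction {P : ExtMod Y W → Prop} (hmono : ∀ k (v : Fin k → Y) w, P (mono v w))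
    (hadd : ∀ a b, P a → P b → P (a + b)) (m : ExtMod Y W) : P m := by
  have hs : m ∈ Submodule.span ℂ {m : ExtMod Y W | ∃ k, ∃ v : Fin k → Y, ∃ w, m = mono v w} := by
    induction m using induction with
    | hemb w => exact Submodule.subset_span ⟨0, _, w, emb_eq_mono w⟩
    | hadd a b ha hb => exact Submodule.add_mem _ ha hb
    | hmul y a ha =>
      induction ha using Submodule.span_induction with
      | mem m hm =>
        obtain ⟨k, v, w, rfl⟩ := hm
        exact Submodule.subset_span ⟨k + 1, _, w, lmul_mono y v w⟩
      | zero => rw [map_zero]; exact Submodule.zero_mem _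
      | add a b _ _ ha hb => rw [map_add]; exact Submodule.add_mem _ ha hb
      | smul c a _ ha => rw [map_smul]; exact Submodule.smul_mem _ c ha
  suffices h : ∀ c : ℂ, P (c • m) by simpa using h 1
  induction hs using Submodule.span_induction with
  | mem m hm =>
    obtain ⟨k, v, w, rfl⟩ := hm
    intro c
    rw [mono, ← map_smul]
    exact hmono k v _
  | zero =>
    intro c
    have := hmono 0 (![] : Fin 0 → Y) (0 : W)
    rwa [mono, map_zero, ← smul_zero c] at this
  | add a b _ _ ha hb => intro c; rw [smul_add]; exact hadd _ _ (ha c) (hb c)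
  | smul d a _ ha => intro c; rw [smul_smul]; exact ha _

variable [FiniteDimensional ℂ Y]

theorem mono_eq_zero {k : ℕ} (hk : finrank ℂ Y < k) (v : Fin k → Y) (w : W) :
    mono v w = (0 : ExtMod Y W) := by
  rw [mono, AlternatingMap.map_linearDependent, map_zero, LinearMap.zero_apply]
  intro h
  have := h.fintype_card_le_finrank
  rw [Fintype.card_fin] at this
  omega

theorem mono_finrank (v : Fin (finrank ℂ Y) → Y) (w : W) :
    mono v w = mono (Module.finBasis ℂ Y) ((Module.finBasis ℂ Y).det v • w) := by
  have : ExteriorAlgebra.ιMulti ℂ (finrank ℂ Y) =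
      (Module.finBasis ℂ Y).det.smulRight
        (ExteriorAlgebra.ιMulti ℂ (finrank ℂ Y) (Module.finBasis ℂ Y)) := by
    refine Basis.ext_alternating (Module.finBasis ℂ Y) fun v hv => ?_
    obtain ⟨e, rfl⟩ : ∃ e : Equiv.Perm (Fin (finrank ℂ Y)), ⇑e = v :=
      ⟨Equiv.ofBijective v (Finite.injective_iff_bijective.1 hv), rfl⟩
    have h1 := (ExteriorAlgebra.ιMulti ℂ (finrank ℂ Y)).map_perm (Module.finBasis ℂ Y) e
    have h2 := (Module.finBasis ℂ Y).det.map_perm (Module.finBasis ℂ Y) e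
    rw [AlternatingMap.smulRight_apply]
    simp only [Function.comp_def] at h1 h2
    rw [h1, h2, Basis.det_self]
    rcases Int.units_eq_one_or (Equiv.Perm.sign e) with h | h <;> simp [h]
  rw [mono, mono, map_smul, ← LinearMap.smul_apply, ← map_smul]
  exact congrArg (fun f => tmul Y W (f v) w) this

variable (Y W) in
/-- The projection onto the top degree part. -/
def top : ExtMod Y W →ₗ[ℂ] W :=
  lift (LinearMap.lsmul ℂ W ∘ₗ ExteriorAlgebra.liftAlternating
    (Pi.single (finrank ℂ Y) (Module.finBasis ℂ Y).det))

theorem top_mono (v : Fin (finrank ℂ Y) → Y) (w : W) :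
    top Y W (mono v w) = (Module.finBasis ℂ Y).det v • w := by
  simp [top, mono, lift_tmul, ExteriorAlgebra.liftAlternating_apply_ιMulti]

theorem top_mono_of_ne {k : ℕ} (hk : k ≠ finrank ℂ Y) (v : Fin k → Y) (w : W) :
    top Y W (mono v w) = 0 := by
  simp [top, mono, lift_tmul, ExteriorAlgebra.liftAlternating_apply_ιMulti, Pi.single_eq_of_ne hk]

/-- A vector killed by all of `Y` lies in the top degree part. -/
theorem exists_eq_mono_of_lmul_eq_zero {m : ExtMod Y W} (hm : ∀ y, lmul W y m = 0) :
    ∃ w, m = mono (Module.finBasis ℂ Y) w := by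
  set b := Module.finBasis ℂ Y
  let B : List (Fin (finrank ℂ Y)) → ExtMod Y W →ₗ[ℂ] ExtMod Y W := fun l =>
    mul W (l.map fun i => ExteriorAlgebra.ι ℂ (b i)).prod
  have hB : ∀ i l u, B (i :: l) u = lmul W (b i) (B l u) := fun i l u => by
    simp only [B, List.map_cons, List.prod_cons, ← mul_mul]; rfl
  have hc : ∀ j l, j ∉ l → ∀ u, ∃ u', contract (b.coord j) (B l u) = B l u' := by
    intro j l
    induction l with
    | nil =>
      intro _ u
      have : ∀ u, B [] u = u := mul_one_left
      exact ⟨contract (b.coord j) u, by rw [this, this]⟩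
    | cons i l ih =>
      intro hj u
      rw [List.mem_cons, not_or] at hj
      obtain ⟨u', hu'⟩ := ih hj.2 u
      refine ⟨-u', ?_⟩
      rw [hB, hB, contract_lmul, hu', map_neg, map_neg]
      simp [Ne.symm hj.1]
  have key : ∀ l : List (Fin (finrank ℂ Y)), l.Nodup → ∃ u, m = B l u := by
    intro l
    induction l with
    | nil => exact fun _ => ⟨m, (mul_one_left m).symm⟩
    | cons i l ih =>
      intro hl
      rw [List.nodup_cons] at hl
      obtain ⟨u, hu⟩ := ih hl.2
      obtain ⟨u', hu'⟩ := hc i l hl.1 u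
      refine ⟨u', ?_⟩
      have h0 := contract_lmul (b.coord i) (b i) m
      rw [hm, map_zero, Basis.coord_apply, Basis.repr_self, Finsupp.single_eq_same, one_smul,
        eq_comm, sub_eq_zero] at h0
      rw [hB, ← hu', ← hu, ← h0]
  obtain ⟨u, hu⟩ := key (List.finRange _) (List.nodup_finRange _)
  have hBf : ∀ u, B (List.finRange _) u = mul W (ExteriorAlgebra.ιMulti ℂ _ b) u := fun u => by
    simp only [B, ExteriorAlgebra.ιMulti_apply, List.ofFn_eq_map]
  have hmono : ∀ u, ∃ w, B (List.finRange _) u = mono b w := by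
    intro u
    simp only [hBf]
    induction u using mono_induction with
    | hmono k v w =>
      rcases k with _ | k
      · refine ⟨w, ?_⟩
        rw [mono, ExteriorAlgebra.ιMulti_zero_apply, mul_tmul, mul_one, mono]
      · refine ⟨0, ?_⟩
        rw [mono, mul_tmul, ExteriorAlgebra.ιMulti_mul_ιMulti, mono, map_zero]
        exact mono_eq_zero (by omega) _ _
    | hadd x y hx hy =>
      obtain ⟨w, hw⟩ := hx
      obtain ⟨w', hw'⟩ := hy
      exact ⟨w + w', by rw [map_add, hw, hw', mono, mono, mono, map_add]⟩
  rw [hu]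
  exact hmono u

end Monomials

end ExtMod

namespace GLSA

variable (L : GLSA)

/-- The bracket `𝔤₀ × 𝔤₋₁ → 𝔤₋₁`. -/
def br0n : L.g0 →ₗ[ℂ] L.gneg →ₗ[ℂ] L.gneg :=
  LinearMap.mk₂ ℂ (fun h y => ⟨L.bracket h y, L.br_0n h h.2 y y.2⟩)
    (fun _ _ _ => Subtype.ext (by simp)) (fun _ _ _ => Subtype.ext (by simp))
    (fun _ _ _ => Subtype.ext (by simp)) (fun _ _ _ => Subtype.ext (by simp))

/-- The bracket `𝔤₀ × 𝔤₁ → 𝔤₁`. -/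
def br0p : L.g0 →ₗ[ℂ] L.gpos →ₗ[ℂ] L.gpos :=
  LinearMap.mk₂ ℂ (fun h y => ⟨L.bracket h y, L.br_0p h h.2 y y.2⟩)
    (fun _ _ _ => Subtype.ext (by simp)) (fun _ _ _ => Subtype.ext (by simp))
    (fun _ _ _ => Subtype.ext (by simp)) (fun _ _ _ => Subtype.ext (by simp))

/-- The bracket `𝔤₀ × 𝔤₀ → 𝔤₀`. -/
def br00 : L.g0 →ₗ[ℂ] L.g0 →ₗ[ℂ] L.g0 :=
  LinearMap.mk₂ ℂ (fun h y => ⟨L.bracket h y, L.br_00 h h.2 y y.2⟩)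
    (fun _ _ _ => Subtype.ext (by simp)) (fun _ _ _ => Subtype.ext (by simp))
    (fun _ _ _ => Subtype.ext (by simp)) (fun _ _ _ => Subtype.ext (by simp))

/-- The bracket `𝔤₁ × 𝔤₋₁ → 𝔤₀`. -/
def brpn : L.gpos →ₗ[ℂ] L.gneg →ₗ[ℂ] L.g0 :=
  LinearMap.mk₂ ℂ (fun x y => ⟨L.bracket x y, L.br_pn x x.2 y y.2⟩)
    (fun _ _ _ => Subtype.ext (by simp)) (fun _ _ _ => Subtype.ext (by simp))
    (fun _ _ _ => Subtype.ext (by simp)) (fun _ _ _ => Subtype.ext (by simp))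

variable {L}

theorem br0n_brpn_self (x : L.gpos) (y : L.gneg) : L.br0n (L.brpn x y) y = 0 := by
  refine Subtype.ext ?_
  change L.bracket (L.bracket x y) y = 0
  have h := L.jacobi_oo x (L.gpos_le_odd x.2) y (L.gneg_le_odd y.2) y
  rw [L.br_nn y y.2 y y.2, map_zero, ← neg_eq_iff_eq_neg.2 (L.skew_e _ (L.br_pn x x.2 y y.2) y),
    sub_neg_eq_add, ← two_smul ℂ, eq_comm] at h
  exact (smul_eq_zero.1 h).resolve_left two_ne_zero

theorem br0n_bracket (h h' : L.g0) (y : L.gneg) :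
    L.br0n (L.br00 h h') y = L.br0n h (L.br0n h' y) - L.br0n h' (L.br0n h y) := by
  refine Subtype.ext (eq_sub_of_add_eq ?_)
  exact (L.jacobi_e h h' y (Or.inl h.2)).symm

theorem br00_brpn (h : L.g0) (x : L.gpos) (y : L.gneg) :
    L.br00 h (L.brpn x y) = L.brpn (L.br0p h x) y + L.brpn x (L.br0n h y) :=
  Subtype.ext (L.jacobi_e h x y (Or.inl h.2))

theorem br0n_brpn_brpn (x x' : L.gpos) (y : L.gneg) :
    L.br0p (L.brpn x y) x' + L.br0p (L.brpn x' y) x = 0 := by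
  refine Subtype.ext ?_
  change L.bracket (L.bracket x y) x' + L.bracket (L.bracket x' y) x = 0
  have h := L.jacobi_oo x (L.gpos_le_odd x.2) x' (L.gpos_le_odd x'.2) y
  rw [L.br_pp x x.2 x' x'.2, map_zero, LinearMap.zero_apply, zero_sub] at h
  rw [L.skew_e _ (L.br_pn x x.2 y y.2), L.skew_e _ (L.br_pn x' x'.2 y y.2), h]
  abel

variable (L) in
/-- The decomposition `𝔤 = 𝔤₀ ⊕ 𝔤₋₁ ⊕ 𝔤₁`. -/
def decomp : (L.g0 × L.gneg × L.gpos) ≃ₗ[ℂ] L.carrier :=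
  LinearEquiv.ofBijective (L.g0.subtype.coprod (L.gneg.subtype.coprod L.gpos.subtype)) (by
    constructor
    · rw [← LinearMap.ker_eq_bot, LinearMap.ker_eq_bot']
      rintro ⟨h, y, x⟩ e
      change (h : L.carrier) + (y + x) = 0 at e
      have h0 : (h : L.carrier) = 0 := Submodule.disjoint_def.1 L.oddCompl.disjoint h h.2 (by
        rw [eq_neg_of_add_eq_zero_left e]
        exact neg_mem (Submodule.add_mem_sup y.2 x.2))
      rw [h0, zero_add] at e
      have y0 : (y : L.carrier) = 0 := Submodule.disjoint_def.1 L.disjNP y y.2 (by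
        rw [eq_neg_of_add_eq_zero_left e]
        exact neg_mem x.2)
      rw [y0, zero_add] at e
      exact Prod.ext (Subtype.ext h0) (Prod.ext (Subtype.ext y0) (Subtype.ext e))
    · intro z
      obtain ⟨h, hh, y, hy, x, hx, rfl⟩ := L.exists_decomp z
      exact ⟨(⟨h, hh⟩, ⟨y, hy⟩, ⟨x, hx⟩), (add_assoc _ _ _).symm⟩)

theorem decomp_apply (p : L.g0 × L.gneg × L.gpos) :
    L.decomp p = (p.1 : L.carrier) + (p.2.1 + p.2.2) := rfl

theorem decomp_symm_even (h : L.g0) : L.decomp.symm h = (h, 0, 0) :=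
  L.decomp.symm_apply_eq.2 (by simp [decomp_apply])

theorem decomp_symm_neg (y : L.gneg) : L.decomp.symm y = (0, y, 0) :=
  L.decomp.symm_apply_eq.2 (by simp [decomp_apply])

theorem decomp_symm_pos (x : L.gpos) : L.decomp.symm x = (0, 0, x) :=
  L.decomp.symm_apply_eq.2 (by simp [decomp_apply])

end GLSA

namespace SMod

variable {L : GLSA} {X : Type} [AddCommGroup X] [Module ℂ X]

section Pieces

variable (a₀ : L.g0 →ₗ[ℂ] X →ₗ[ℂ] X) (aₙ : L.gneg →ₗ[ℂ] X →ₗ[ℂ] X) (aₚ : L.gpos →ₗ[ℂ] X →ₗ[ℂ] X)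

/-- The action of `𝔤` assembled from the actions of its homogeneous components. -/
def pieceAct : L.carrier →ₗ[ℂ] X →ₗ[ℂ] X :=
  (a₀.coprod (aₙ.coprod aₚ)) ∘ₗ L.decomp.symm.toLinearMap

theorem pieceAct_even {x : L.carrier} (hx : x ∈ L.g0) : pieceAct a₀ aₙ aₚ x = a₀ ⟨x, hx⟩ := by
  have := GLSA.decomp_symm_even ⟨x, hx⟩
  simp only at this
  simp [pieceAct, this]

theorem pieceAct_neg {x : L.carrier} (hx : x ∈ L.gneg) : pieceAct a₀ aₙ aₚ x = aₙ ⟨x, hx⟩ := by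
  have := GLSA.decomp_symm_neg ⟨x, hx⟩
  simp only at this
  simp [pieceAct, this]

theorem pieceAct_pos {x : L.carrier} (hx : x ∈ L.gpos) : pieceAct a₀ aₙ aₚ x = aₚ ⟨x, hx⟩ := by
  have := GLSA.decomp_symm_pos ⟨x, hx⟩
  simp only at this
  simp [pieceAct, this]

/-- A supermodule assembled from actions of the homogeneous components. -/
def ofPieces (σ : X →ₗ[ℂ] X) (hσ : ∀ m, σ (σ m) = m)
    (h₀σ : ∀ h m, a₀ h (σ m) = σ (a₀ h m)) (hₙσ : ∀ y m, aₙ y (σ m) = -σ (aₙ y m))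
    (hₚσ : ∀ x m, aₚ x (σ m) = -σ (aₚ x m))
    (h₀₀ : ∀ h h' m, a₀ (L.br00 h h') m = a₀ h (a₀ h' m) - a₀ h' (a₀ h m))
    (h₀ₙ : ∀ h y m, aₙ (L.br0n h y) m = a₀ h (aₙ y m) - aₙ y (a₀ h m))
    (h₀ₚ : ∀ h x m, aₚ (L.br0p h x) m = a₀ h (aₚ x m) - aₚ x (a₀ h m))
    (hₚₙ : ∀ x y m, a₀ (L.brpn x y) m = aₚ x (aₙ y m) + aₙ y (aₚ x m))
    (hₙₙ : ∀ y m, aₙ y (aₙ y m) = 0) (hₚₚ : ∀ x m, aₚ x (aₚ x m) = 0) : SMod L :=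
  have hev : ∀ x ∈ L.g0, ∀ y m, pieceAct a₀ aₙ aₚ (L.bracket x y) m =
      pieceAct a₀ aₙ aₚ x (pieceAct a₀ aₙ aₚ y m) - pieceAct a₀ aₙ aₚ y (pieceAct a₀ aₙ aₚ x m) := by
    intro x hx z m
    obtain ⟨h, hh, y, hy, p, hp, rfl⟩ := L.exists_decomp z
    simp only [map_add, LinearMap.add_apply, pieceAct_even _ _ _ hx, pieceAct_even _ _ _ hh,
      pieceAct_neg _ _ _ hy, pieceAct_pos _ _ _ hp, pieceAct_even _ _ _ (L.br_00 x hx h hh),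
      pieceAct_neg _ _ _ (L.br_0n x hx y hy), pieceAct_pos _ _ _ (L.br_0p x hx p hp)]
    have e₁ := h₀₀ ⟨x, hx⟩ ⟨h, hh⟩ m
    have e₂ := h₀ₙ ⟨x, hx⟩ ⟨y, hy⟩ m
    have e₃ := h₀ₚ ⟨x, hx⟩ ⟨p, hp⟩ m
    simp only [GLSA.br00, GLSA.br0n, GLSA.br0p, LinearMap.mk₂_apply] at e₁ e₂ e₃
    rw [e₁, e₂, e₃]
    abel
  ofInvolution (pieceAct a₀ aₙ aₚ) σ hσ
    (fun x hx m => by rw [pieceAct_even _ _ _ hx, h₀σ])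
    (fun x hx m => by
      obtain ⟨y, hy, p, hp, rfl⟩ := Submodule.mem_sup.1 hx
      simp only [map_add, LinearMap.add_apply, pieceAct_neg _ _ _ hy, pieceAct_pos _ _ _ hp,
        hₙσ, hₚσ, neg_add])
    (fun x y h m => by
      rcases h with hx | hy
      · exact hev x hx y m
      · rw [← neg_eq_iff_eq_neg.2 (L.skew_e y hy x), map_neg, LinearMap.neg_apply, hev y hy x m]
        abel)
    (fun z hz z' hz' m => by
      obtain ⟨y, hy, x, hx, rfl⟩ := Submodule.mem_sup.1 hz
      obtain ⟨y', hy', x', hx', rfl⟩ := Submodule.mem_sup.1 hz'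
      have e₁ := hₚₙ ⟨x, hx⟩ ⟨y', hy'⟩ m
      have e₂ := hₚₙ ⟨x', hx'⟩ ⟨y, hy⟩ m
      have e₃ := anticomm_of_sq_zero hₙₙ ⟨y, hy⟩ ⟨y', hy'⟩ m
      have e₄ := anticomm_of_sq_zero hₚₚ ⟨x, hx⟩ ⟨x', hx'⟩ m
      simp only [GLSA.brpn, LinearMap.mk₂_apply] at e₁ e₂
      simp only [map_add, LinearMap.add_apply, L.br_nn y hy y' hy', L.br_pp x hx x' hx',
        L.skew_oo y (L.gneg_le_odd hy) x' (L.gpos_le_odd hx'),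
        pieceAct_neg _ _ _ hy, pieceAct_pos _ _ _ hx, pieceAct_neg _ _ _ hy',
        pieceAct_pos _ _ _ hx', pieceAct_even _ _ _ (L.br_pn x hx y' hy'),
        pieceAct_even _ _ _ (L.br_pn x' hx' y hy), e₁, e₂, e₃, e₄, map_zero, LinearMap.zero_apply]
      abel)

end Pieces

end SMod

namespace SMod0

variable {L : GLSA} (W : SMod0 L)

/-- The action of `𝔤₀` on `Λ(𝔤₋₁) ⊗ W`. -/
def kac0 : ExtMod L.gneg W.carrier →ₗ[ℂ] L.g0 →ₗ[ℂ] ExtMod L.gneg W.carrier :=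
  ExtMod.recHom (W.act.compr₂ (ExtMod.emb L.gneg)).flip
    (LinearMap.mk₂ ℂ (fun y m => (ExtMod.lmul W.carrier).flip m ∘ₗ L.br0n.flip y)
      (fun _ _ _ => LinearMap.ext fun _ => by simp) (fun _ _ _ => LinearMap.ext fun _ => by simp)
      (fun _ _ _ => LinearMap.ext fun _ => by simp) (fun _ _ _ => LinearMap.ext fun _ => by simp))
    (LinearMap.mk₂ ℂ (fun y φ => ExtMod.lmul W.carrier y ∘ₗ φ)
      (fun _ _ _ => LinearMap.ext fun _ => by simp) (fun _ _ _ => LinearMap.ext fun _ => by simp)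
      (fun _ _ _ => LinearMap.ext fun _ => by simp) (fun _ _ _ => LinearMap.ext fun _ => by simp))
    (fun y m => LinearMap.ext fun h => by
      simp [anticomm_of_sq_zero ExtMod.lmul_lmul (L.br0n h y) y m])
    (fun y φ => LinearMap.ext fun h => by simp [ExtMod.lmul_lmul])

theorem kac0_emb (w : W.carrier) (h : L.g0) :
    W.kac0 (ExtMod.emb _ w) h = ExtMod.emb _ (W.act h w) := by
  rw [kac0, ExtMod.recHom_emb]; rfl

theorem kac0_lmul (y : L.gneg) (m : ExtMod L.gneg W.carrier) (h : L.g0) :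
    W.kac0 (ExtMod.lmul _ y m) h =
      ExtMod.lmul _ (L.br0n h y) m + ExtMod.lmul _ y (W.kac0 m h) := by
  rw [kac0, ExtMod.recHom_lmul]; rfl

/-- The action of `𝔤₁` on `Λ(𝔤₋₁) ⊗ W`. -/
def kacPos : ExtMod L.gneg W.carrier →ₗ[ℂ] L.gpos →ₗ[ℂ] ExtMod L.gneg W.carrier :=
  ExtMod.recHom 0
    (LinearMap.mk₂ ℂ (fun y m => W.kac0 m ∘ₗ L.brpn.flip y)
      (fun _ _ _ => LinearMap.ext fun _ => by simp) (fun _ _ _ => LinearMap.ext fun _ => by simp)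
      (fun _ _ _ => LinearMap.ext fun _ => by simp) (fun _ _ _ => LinearMap.ext fun _ => by simp))
    (LinearMap.mk₂ ℂ (fun y φ => -(ExtMod.lmul W.carrier y ∘ₗ φ))
      (fun _ _ _ => LinearMap.ext fun _ => by simp; abel)
      (fun _ _ _ => LinearMap.ext fun _ => by simp)
      (fun _ _ _ => LinearMap.ext fun _ => by simp; abel)
      (fun _ _ _ => LinearMap.ext fun _ => by simp))
    (fun y m => LinearMap.ext fun x => by
      simp [kac0_lmul, GLSA.br0n_brpn_self])
    (fun y φ => LinearMap.ext fun h => by simp [ExtMod.lmul_lmul])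

theorem kacPos_emb (w : W.carrier) (x : L.gpos) : W.kacPos (ExtMod.emb _ w) x = 0 := by
  rw [kacPos, ExtMod.recHom_emb]; rfl

theorem kacPos_lmul (y : L.gneg) (m : ExtMod L.gneg W.carrier) (x : L.gpos) :
    W.kacPos (ExtMod.lmul _ y m) x =
      W.kac0 m (L.brpn x y) - ExtMod.lmul _ y (W.kacPos m x) := by
  rw [kacPos, ExtMod.recHom_lmul, sub_eq_add_neg]; rfl

theorem kac0_br00 (h h' : L.g0) (m : ExtMod L.gneg W.carrier) :
    W.kac0 m (L.br00 h h') = W.kac0 (W.kac0 m h') h - W.kac0 (W.kac0 m h) h' := by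
  induction m using ExtMod.induction with
  | hemb w =>
    simp only [kac0_emb, ← map_sub]
    exact congrArg _ (W.act_br h h' w)
  | hadd a b ha hb => simp only [map_add, LinearMap.add_apply, ha, hb]; abel
  | hmul y m ih =>
    simp only [kac0_lmul, GLSA.br0n_bracket, ih, map_add, map_sub, LinearMap.add_apply,
      LinearMap.sub_apply]
    abel

theorem kacPos_br0p (h : L.g0) (x : L.gpos) (m : ExtMod L.gneg W.carrier) :
    W.kacPos m (L.br0p h x) = W.kac0 (W.kacPos m x) h - W.kacPos (W.kac0 m h) x := by
  induction m using ExtMod.induction with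
  | hemb w => simp [kacPos_emb, kac0_emb]
  | hadd a b ha hb => simp only [map_add, LinearMap.add_apply, ha, hb]; abel
  | hmul y m ih =>
    have := W.kac0_br00 h (L.brpn x y) m
    rw [GLSA.br00_brpn, map_add] at this
    simp only [kacPos_lmul, kac0_lmul, ih, map_add, map_sub, LinearMap.add_apply,
      LinearMap.sub_apply]
    rw [eq_sub_of_add_eq this]
    abel

theorem kacPos_kacPos (x : L.gpos) (m : ExtMod L.gneg W.carrier) :
    W.kacPos (W.kacPos m x) x = 0 := by
  induction m using ExtMod.induction with
  | hemb w => simp [kacPos_emb]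
  | hadd a b ha hb => simp only [map_add, LinearMap.add_apply, ha, hb, add_zero]
  | hmul y m ih =>
    have h := GLSA.br0n_brpn_brpn x x y
    rw [← two_smul ℂ] at h
    have := W.kacPos_br0p (L.brpn x y) x m
    rw [(smul_eq_zero.1 h).resolve_left two_ne_zero, map_zero, eq_comm, sub_eq_zero] at this
    simp only [kacPos_lmul, map_sub, LinearMap.sub_apply, ih, map_zero, this]
    abel

theorem kac0_sign (h : L.g0) (m : ExtMod L.gneg W.carrier) :
    W.kac0 (ExtMod.sign W.par m) h = ExtMod.sign W.par (W.kac0 m h) := by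
  induction m using ExtMod.induction with
  | hemb w => simp only [kac0_emb, ExtMod.sign_emb, W.act_par]
  | hadd a b ha hb => simp only [map_add, LinearMap.add_apply, ha, hb]
  | hmul y m ih =>
    simp only [kac0_lmul, ExtMod.sign_lmul, map_neg, map_add, LinearMap.neg_apply, ih, neg_add]

theorem kacPos_sign (x : L.gpos) (m : ExtMod L.gneg W.carrier) :
    W.kacPos (ExtMod.sign W.par m) x = -ExtMod.sign W.par (W.kacPos m x) := by
  induction m using ExtMod.induction with
  | hemb w => simp [kacPos_emb, ExtMod.sign_emb]
  | hadd a b ha hb => simp only [map_add, LinearMap.add_apply, ha, hb, neg_add]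
  | hmul y m ih =>
    simp only [kacPos_lmul, ExtMod.sign_lmul, map_neg, map_sub, LinearMap.neg_apply, ih, kac0_sign]

/-- The Kac module realised on `Λ(𝔤₋₁) ⊗ W`. -/
def kac : SMod L :=
  SMod.ofPieces W.kac0.flip (ExtMod.lmul W.carrier) W.kacPos.flip (ExtMod.sign W.par)
    (ExtMod.sign_sign W.par_par) (fun h m => W.kac0_sign h m)
    (fun y m => by rw [ExtMod.sign_lmul, neg_neg]) (fun x m => W.kacPos_sign x m)
    (fun h h' m => W.kac0_br00 h h' m)
    (fun h y m => by simp [kac0_lmul])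
    (fun h x m => W.kacPos_br0p h x m)
    (fun x y m => by simp [kacPos_lmul])
    ExtMod.lmul_lmul (fun x m => W.kacPos_kacPos x m)

theorem kac_act_even {x : L.carrier} (hx : x ∈ L.g0) (m : ExtMod L.gneg W.carrier) :
    W.kac.act x m = W.kac0 m ⟨x, hx⟩ :=
  LinearMap.congr_fun (SMod.pieceAct_even _ _ _ hx) m

theorem kac_act_neg {x : L.carrier} (hx : x ∈ L.gneg) (m : ExtMod L.gneg W.carrier) :
    W.kac.act x m = ExtMod.lmul W.carrier ⟨x, hx⟩ m :=
  LinearMap.congr_fun (SMod.pieceAct_neg _ _ _ hx) m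

theorem kac_act_pos {x : L.carrier} (hx : x ∈ L.gpos) (m : ExtMod L.gneg W.carrier) :
    W.kac.act x m = W.kacPos m ⟨x, hx⟩ :=
  LinearMap.congr_fun (SMod.pieceAct_pos _ _ _ hx) m

theorem kac_par (m : ExtMod L.gneg W.carrier) : W.kac.par m = ExtMod.sign W.par m :=
  parityOp_plusSpace_minusSpace (ExtMod.sign_sign W.par_par) m

end SMod0

theorem Basis.det_update_self {ι Y : Type} [AddCommGroup Y] [Module ℂ Y] [Fintype ι]
    [DecidableEq ι] (b : Basis ι ℂ Y) (i : ι) (y : Y) : b.det (update b i y) = b.repr y i := by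
  conv_lhs => rw [← b.sum_repr y]
  rw [AlternatingMap.map_update_sum, Finset.sum_eq_single i]
  · rw [AlternatingMap.map_update_smul, update_eq_self, b.det_self, smul_eq_mul, mul_one]
  · intro j _ hj
    rw [AlternatingMap.map_update_smul, AlternatingMap.map_update_self _ _ hj.symm, smul_zero]
  · simp

theorem Basis.sum_det_update_self {ι Y : Type} [AddCommGroup Y] [Module ℂ Y] [Fintype ι]
    [DecidableEq ι] (b : Basis ι ℂ Y) (f : Y →ₗ[ℂ] Y) :
    ∑ i, b.det (update b i (f (b i))) = LinearMap.trace ℂ Y f := by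
  rw [LinearMap.trace_eq_matrix_trace ℂ b, Matrix.trace]
  exact Finset.sum_congr rfl fun i _ => by
    rw [Basis.det_update_self, Matrix.diag_apply, LinearMap.toMatrix_apply]

namespace ExtMod

variable {Y W : Type} [AddCommGroup Y] [Module ℂ Y] [AddCommGroup W] [Module ℂ W]

theorem mono_cons {k : ℕ} (y : Y) (v : Fin k → Y) (w : W) :
    mono (Fin.cons y v : Fin (k + 1) → Y) w = lmul W y (mono v w) := (lmul_mono y v w).symm

theorem sign_mono (σ : W →ₗ[ℂ] W) {k : ℕ} (v : Fin k → Y) (w : W) :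
    sign σ (mono v w) = (-1 : ℂ) ^ k • mono v (σ w) := by
  induction k with
  | zero =>
    rw [Subsingleton.elim v ![], ← emb_eq_mono, sign_emb, ← emb_eq_mono, pow_zero, one_smul]
  | succ k ih =>
    rw [← Fin.cons_self_tail v, mono_cons, mono_cons, sign_lmul, ih, map_smul, pow_succ]
    simp

variable (Y W) in
/-- The part of degree less than `k`. -/
def degLT (k : ℕ) : Submodule ℂ (ExtMod Y W) :=
  Submodule.span ℂ {m | ∃ j < k, ∃ (v : Fin j → Y) (w : W), m = mono v w}

theorem lmul_mem_degLT {k : ℕ} (y : Y) {m : ExtMod Y W} (hm : m ∈ degLT Y W k) :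
    lmul W y m ∈ degLT Y W (k + 1) := by
  suffices h : degLT Y W k ≤ (degLT Y W (k + 1)).comap (lmul W y) from h hm
  refine Submodule.span_le.2 ?_
  rintro _ ⟨j, hj, v, w, rfl⟩
  exact Submodule.subset_span ⟨j + 1, Nat.succ_lt_succ hj, _, w, lmul_mono y v w⟩

variable [FiniteDimensional ℂ Y]

theorem top_sign (σ : W →ₗ[ℂ] W) (m : ExtMod Y W) :
    top Y W (sign σ m) = (-1 : ℂ) ^ finrank ℂ Y • σ (top Y W m) := by
  induction m using mono_induction with
  | hadd a b ha hb => simp only [map_add, smul_add, ha, hb]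
  | hmono k v w =>
    rw [sign_mono, map_smul]
    by_cases hk : k = finrank ℂ Y
    · subst hk
      rw [top_mono, top_mono, map_smul]
    · rw [top_mono_of_ne hk, top_mono_of_ne hk, map_zero, smul_zero, smul_zero]

theorem top_mono_finBasis (w : W) : top Y W (mono (Module.finBasis ℂ Y) w) = w := by
  rw [top_mono, Basis.det_self, one_smul]

theorem top_eq_zero_of_mem_degLT {k : ℕ} (hk : k ≤ finrank ℂ Y) {m : ExtMod Y W}
    (hm : m ∈ degLT Y W k) : top Y W m = 0 := by
  suffices h : degLT Y W k ≤ LinearMap.ker (top Y W) from h hm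
  refine Submodule.span_le.2 ?_
  rintro _ ⟨j, hj, v, w, rfl⟩
  exact top_mono_of_ne (hj.trans_le hk).ne v w

end ExtMod

namespace SMod0

variable {L : GLSA} (W : SMod0 L)

theorem kac0_mono (h : L.g0) {k : ℕ} (v : Fin k → L.gneg) (w : W.carrier) :
    W.kac0 (ExtMod.mono v w) h =
      ∑ i, ExtMod.mono (update v i (L.br0n h (v i))) w + ExtMod.mono v (W.act h w) := by
  induction k with
  | zero =>
    rw [Subsingleton.elim v ![], ← ExtMod.emb_eq_mono, kac0_emb, ← ExtMod.emb_eq_mono,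
      Finset.univ_eq_empty, Finset.sum_empty, zero_add]
  | succ k ih =>
    obtain ⟨y, v, rfl⟩ : ∃ y v', v = Fin.cons y v' := ⟨_, _, (Fin.cons_self_tail v).symm⟩
    rw [ExtMod.mono_cons, kac0_lmul, ih, Fin.sum_univ_succ, Fin.cons_zero, Fin.update_cons_zero,
      ExtMod.mono_cons, ExtMod.mono_cons, map_add, map_sum, add_assoc]
    simp only [Fin.cons_succ, ← Fin.cons_update, ExtMod.mono_cons]

theorem kacPos_mono (x : L.gpos) {k : ℕ} (v : Fin k → L.gneg) (w : W.carrier) :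
    W.kacPos (ExtMod.mono v w) x ∈ ExtMod.degLT L.gneg W.carrier k := by
  induction k with
  | zero =>
    rw [Subsingleton.elim v ![], ← ExtMod.emb_eq_mono, kacPos_emb]
    exact zero_mem _
  | succ k ih =>
    rw [← Fin.cons_self_tail v, ExtMod.mono_cons, kacPos_lmul, kac0_mono]
    have hmem : ∀ (u : Fin k → L.gneg) (w : W.carrier),
        ExtMod.mono u w ∈ ExtMod.degLT L.gneg W.carrier (k + 1) :=
      fun u w => Submodule.subset_span ⟨k, k.lt_succ_self, u, w, rfl⟩
    exact sub_mem (add_mem (sum_mem fun _ _ => hmem _ _) (hmem _ _)) (ExtMod.lmul_mem_degLT _ (ih _))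

variable [FiniteDimensional ℂ L.gneg]

theorem top_kac0 (h : L.g0) (m : ExtMod L.gneg W.carrier) :
    ExtMod.top _ _ (W.kac0 m h) =
      W.act h (ExtMod.top _ _ m) + traceCharNeg L h • ExtMod.top _ _ m := by
  induction m using ExtMod.mono_induction with
  | hadd a b ha hb => simp only [map_add, LinearMap.add_apply, smul_add, ha, hb]; abel
  | hmono k v w =>
    by_cases hk : k = finrank ℂ L.gneg
    · subst hk
      rw [ExtMod.mono_finrank]
      generalize (Module.finBasis ℂ L.gneg).det v • w = w
      rw [kac0_mono, map_add, map_sum, ExtMod.top_mono_finBasis, ExtMod.top_mono_finBasis, add_comm]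
      simp only [ExtMod.top_mono, ← Finset.sum_smul]
      rw [Basis.sum_det_update_self]
      rfl
    · rw [kac0_mono, map_add, map_sum, ExtMod.top_mono_of_ne hk, ExtMod.top_mono_of_ne hk, map_zero,
        smul_zero, add_zero, add_zero]
      exact Finset.sum_eq_zero fun i _ => ExtMod.top_mono_of_ne hk _ _

theorem top_kacPos (x : L.gpos) (m : ExtMod L.gneg W.carrier) :
    ExtMod.top _ _ (W.kacPos m x) = 0 := by
  induction m using ExtMod.mono_induction with
  | hadd a b ha hb => simp only [map_add, LinearMap.add_apply, ha, hb, add_zero]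
  | hmono k v w =>
    rcases le_or_gt k (finrank ℂ L.gneg) with hk | hk
    · exact ExtMod.top_eq_zero_of_mem_degLT hk (W.kacPos_mono x v w)
    · rw [ExtMod.mono_eq_zero hk, map_zero, LinearMap.zero_apply, map_zero]

end SMod0

theorem parNeg_pow (L : GLSA) : (-1 : ℂ) ^ finrank ℂ L.gneg = if parNeg L then -1 else 1 := by
  rcases Nat.mod_two_eq_zero_or_one (finrank ℂ L.gneg) with h | h
  · simp [parNeg, h, (Nat.even_iff.2 h).neg_one_pow]
  · simp [parNeg, h, (Nat.odd_iff.2 h).neg_one_pow]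

namespace SHom

variable {L : GLSA} {M N : SMod L}

/-- A homomorphism from a linear map commuting with the homogeneous components of `𝔤` and the
parity involution. -/
def ofPieces (f : M.carrier →ₗ[ℂ] N.carrier) (hp : ∀ m, f (M.par m) = N.par (f m))
    (h0 : ∀ x ∈ L.g0, ∀ m, f (M.act x m) = N.act x (f m))
    (hn : ∀ x ∈ L.gneg, ∀ m, f (M.act x m) = N.act x (f m))
    (hq : ∀ x ∈ L.gpos, ∀ m, f (M.act x m) = N.act x (f m)) : SHom M N :=
  ofPar f hp fun z m => by
    obtain ⟨h, hh, y, hy, x, hx, rfl⟩ := L.exists_decomp z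
    simp only [map_add, LinearMap.add_apply, h0 h hh, hn y hy, hq x hx]

end SHom

namespace IsKac

variable {L : GLSA} {W : SMod0 L} {K : SMod L} {η : W.carrier →ₗ[ℂ] K.carrier}

/-- The comparison map from `Λ(𝔤₋₁) ⊗ W` to a Kac module. -/
def ofExt (K : SMod L) (η : W.carrier →ₗ[ℂ] K.carrier) : ExtMod L.gneg W.carrier →ₗ[ℂ] K.carrier :=
  ExtMod.recHom η 0 K.actNeg (fun _ _ => by simp) K.actNeg_sq

theorem ofExt_emb (w : W.carrier) : ofExt K η (ExtMod.emb _ w) = η w := ExtMod.recHom_emb ..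

theorem ofExt_lmul (y : L.gneg) (m : ExtMod L.gneg W.carrier) :
    ofExt K η (ExtMod.lmul _ y m) = K.act y (ofExt K η m) := by
  rw [ofExt, ExtMod.recHom_lmul, LinearMap.zero_apply, LinearMap.zero_apply, zero_add]; rfl

theorem ofExt_kac0 (hK : IsKac W K η) (h : L.g0) (m : ExtMod L.gneg W.carrier) :
    ofExt K η (W.kac0 m h) = K.act h (ofExt K η m) := by
  induction m using ExtMod.induction with
  | hemb w => rw [SMod0.kac0_emb, ofExt_emb, ofExt_emb, hK.equivar]
  | hadd a b ha hb => simp only [map_add, LinearMap.add_apply, ha, hb]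
  | hmul y m ih =>
    rw [SMod0.kac0_lmul, map_add, ofExt_lmul, ofExt_lmul, ofExt_lmul, ih, K.act_act_even h.2]
    exact add_sub_cancel _ _

theorem ofExt_kacPos (hK : IsKac W K η) (x : L.gpos) (m : ExtMod L.gneg W.carrier) :
    ofExt K η (W.kacPos m x) = K.act x (ofExt K η m) := by
  induction m using ExtMod.induction with
  | hemb w => rw [SMod0.kacPos_emb, ofExt_emb, hK.pos_zero x x.2, map_zero]
  | hadd a b ha hb => simp only [map_add, LinearMap.add_apply, ha, hb]
  | hmul y m ih =>
    rw [SMod0.kacPos_lmul, map_sub, ofExt_lmul, ofExt_lmul, ih, ofExt_kac0 hK,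
      K.act_act_odd (L.gpos_le_odd x.2) (L.gneg_le_odd y.2)]
    exact sub_sub_cancel _ _

theorem ofExt_sign (hK : IsKac W K η) (m : ExtMod L.gneg W.carrier) :
    ofExt K η (ExtMod.sign W.par m) = K.par (ofExt K η m) := by
  induction m using ExtMod.induction with
  | hemb w =>
    rw [ExtMod.sign_emb, ofExt_emb, ofExt_emb]
    exact map_parityOp _ _ _ hK.map_ev hK.map_od w
  | hadd a b ha hb => simp only [map_add, ha, hb]
  | hmul y m ih =>
    rw [ExtMod.sign_lmul, map_neg, ofExt_lmul, ofExt_lmul, ih, K.act_par_odd (L.gneg_le_odd y.2),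
      neg_neg]

theorem exists_injective_kac (hK : IsKac W K η) : ∃ Φ : SHom K W.kac, Injective Φ.toLin := by
  let Θ : SHom W.kac K := SHom.ofPieces (ofExt K η)
    (fun m => (congrArg (ofExt K η) (W.kac_par m)).trans (ofExt_sign hK m))
    (fun x hx m => (congrArg (ofExt K η) (W.kac_act_even hx m)).trans (ofExt_kac0 hK ⟨x, hx⟩ m))
    (fun x hx m => (congrArg (ofExt K η) (W.kac_act_neg hx m)).trans (ofExt_lmul ⟨x, hx⟩ m))
    (fun x hx m => (congrArg (ofExt K η) (W.kac_act_pos hx m)).trans (ofExt_kacPos hK ⟨x, hx⟩ m))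
  have hpar : ∀ w, W.kac.par (ExtMod.emb L.gneg w) = ExtMod.emb L.gneg (W.par w) := fun w => by
    rw [W.kac_par, ExtMod.sign_emb]
  obtain ⟨Φ, hΦ, -⟩ := hK.universal W.kac (ExtMod.emb L.gneg)
    (fun w hw => (parityOp_eq_self_iff W.kac.grading).1
      ((hpar w).trans (congrArg _ (parityOp_left W.grading hw))))
    (fun w hw => (parityOp_eq_neg_iff W.kac.grading).1
      ((hpar w).trans ((congrArg _ (parityOp_right W.grading hw)).trans (map_neg _ _))))
    (fun x w => ((W.kac_act_even x.2 _).trans (W.kac0_emb w x)).symm)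
    (fun x hx w => (W.kac_act_pos hx _).trans (W.kacPos_emb w ⟨x, hx⟩))
  refine ⟨Φ, LeftInverse.injective (g := Θ.toLin) fun k => ?_⟩
  have := (hK.universal K η hK.map_ev hK.map_od hK.equivar hK.pos_zero).unique
    (y₁ := Θ.comp Φ) (y₂ := ⟨LinearMap.id, fun _ h => h, fun _ h => h, fun _ _ => rfl⟩)
    (fun w => (congrArg Θ.toLin (hΦ w)).trans (ofExt_emb w)) (fun _ => rfl)
  exact LinearMap.congr_fun (congrArg SHom.toLin this) k

end IsKac

theorem exists_twist {L : GLSA} (V : SMod0 L) :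
    ∃ W : SMod0 L, IsTwistBy V W (fun x => -(traceCharNeg L x)) (parNeg L) := by
  have hadd : ∀ x y : L.g0, traceCharNeg L (x + y) = traceCharNeg L x + traceCharNeg L y :=
    fun x y => map_add (LinearMap.trace ℂ L.gneg ∘ₗ L.br0n) x y
  have hsmul : ∀ (c : ℂ) (x : L.g0), traceCharNeg L (c • x) = c * traceCharNeg L x :=
    fun c x => map_smul (LinearMap.trace ℂ L.gneg ∘ₗ L.br0n) c x
  have hbr : ∀ x y : L.g0, traceCharNeg L ⟨L.bracket x y, L.br_00 x x.2 y y.2⟩ = 0 := by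
    intro x y
    have h : adNeg L ⟨L.bracket x y, L.br_00 x x.2 y y.2⟩ =
        L.br0n x * L.br0n y - L.br0n y * L.br0n x :=
      LinearMap.ext fun z => GLSA.br0n_bracket x y z
    rw [traceCharNeg, h, map_sub, LinearMap.trace_mul_comm, sub_self]
  let act : L.g0 →ₗ[ℂ] V.carrier →ₗ[ℂ] V.carrier :=
    { toFun := fun x => V.act x - traceCharNeg L x • LinearMap.id
      map_add' := fun x y => by rw [map_add, hadd]; module
      map_smul' := fun c x => by rw [map_smul, hsmul, RingHom.id_apply]; module }
  have hact : ∀ x v, act x v = V.act x v - traceCharNeg L x • v := fun _ _ => rfl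
  have hmem : ∀ (x : L.g0) (N : Submodule ℂ V.carrier), (∀ v ∈ N, V.act x v ∈ N) →
      ∀ v ∈ N, act x v ∈ N := fun x N h v hv => sub_mem (h v hv) (N.smul_mem _ hv)
  have hcomm : ∀ (x y : L.g0) (v : V.carrier),
      act ⟨L.bracket x y, L.br_00 x x.2 y y.2⟩ v = act x (act y v) - act y (act x v) := by
    intro x y v
    simp only [hact, hbr, V.act_br x y v, map_sub, map_smul]
    module
  have he : ∀ (x : L.g0) (v : V.carrier), act x v = V.act x v + -traceCharNeg L x • v := fun x v => by
    rw [hact, neg_smul, sub_eq_add_neg]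
  cases hq : parNeg L with
  | true =>
    let W : SMod0 L :=
      { carrier := V.carrier
        act := act
        ev := V.od
        od := V.ev
        grading := V.grading.symm
        act_ev := fun x => hmem x _ (V.act_od x)
        act_od := fun x => hmem x _ (V.act_ev x)
        act_br := hcomm }
    refine ⟨W, LinearEquiv.refl ℂ _, he, ?_⟩
    rw [if_pos rfl]
    exact ⟨fun _ h => h, fun _ h => h⟩
  | false =>
    let W : SMod0 L :=
      { carrier := V.carrier
        act := act
        ev := V.ev
        od := V.od
        grading := V.grading
        act_ev := fun x => hmem x _ (V.act_ev x)
        act_od := fun x => hmem x _ (V.act_od x)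
        act_br := hcomm }
    refine ⟨W, LinearEquiv.refl ℂ _, he, ?_⟩
    rw [if_neg Bool.false_ne_true]
    exact ⟨fun _ h => h, fun _ h => h⟩

section Twist

variable {L : GLSA} [FiniteDimensional ℂ L.gneg]

/-- The Kac module of `V ⊗ Λ^max(𝔤₋₁^*)` embeds into the module coinduced from `V`. -/
theorem exists_kac_injective_coind {V W : SMod0 L} {C : SMod L} {ε : C.carrier →ₗ[ℂ] V.carrier}
    (hC : IsCoindPos V C ε) (hT : IsTwistBy V W (fun x => -(traceCharNeg L x)) (parNeg L)) :
    ∃ Ψ : SHom W.kac C, Injective Ψ.toLin ∧ ∀ v, ∃ m, ε (Ψ.toLin m) = v := by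
  obtain ⟨e, he, hpar⟩ := hT
  have hσ : ∀ v, e (V.par v) = (-1 : ℂ) ^ finrank ℂ L.gneg • W.par (e v) := by
    intro v
    rw [parNeg_pow]
    cases hq : parNeg L with
    | true =>
      rw [hq, if_pos rfl] at hpar
      rw [if_pos rfl, neg_one_smul]
      exact map_parityOp_swap _ _ e.toLinearMap hpar.1 hpar.2 v
    | false =>
      rw [hq, if_neg Bool.false_ne_true] at hpar
      rw [if_neg Bool.false_ne_true, one_smul]
      exact map_parityOp _ _ e.toLinearMap hpar.1 hpar.2 v
  let ψ : W.kac.carrier →ₗ[ℂ] V.carrier := e.symm.toLinearMap ∘ₗ ExtMod.top L.gneg W.carrier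
  have hψ : ∀ m, ψ (W.kac.par m) = V.par (ψ m) := by
    intro m
    refine e.symm_apply_eq.2 ?_
    refine (congrArg (ExtMod.top L.gneg W.carrier) (W.kac_par m)).trans
      ((ExtMod.top_sign W.par m).trans ?_)
    rw [hσ]
    exact congrArg (fun w => (-1 : ℂ) ^ finrank ℂ L.gneg • W.par w) (e.apply_symm_apply _).symm
  obtain ⟨Ψ, hΨ, -⟩ := hC.universal W.kac ψ
    (fun m hm => (parityOp_eq_self_iff V.grading).1
      ((hψ m).symm.trans (congrArg ψ (parityOp_left _ hm))))
    (fun m hm => (parityOp_eq_neg_iff V.grading).1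
      ((hψ m).symm.trans ((congrArg ψ (parityOp_right _ hm)).trans (map_neg _ _))))
    (fun x m => by
      refine e.symm_apply_eq.2 ?_
      have h := he x (ψ m)
      rw [show e (ψ m) = ExtMod.top L.gneg W.carrier m from e.apply_symm_apply _] at h
      refine (congrArg (ExtMod.top L.gneg W.carrier) (W.kac_act_even x.2 m)).trans
        ((W.top_kac0 _ m).trans ?_)
      rw [h]
      module)
    (fun x hx m => by
      refine e.symm_apply_eq.2 ?_
      refine (congrArg (ExtMod.top L.gneg W.carrier) (W.kac_act_pos hx m)).trans
        ((W.top_kacPos _ m).trans (map_zero e).symm))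
  have htop : ∀ w, ψ (ExtMod.mono (Module.finBasis ℂ L.gneg) w) = e.symm w := fun w =>
    congrArg e.symm (ExtMod.top_mono_finBasis w)
  refine ⟨Ψ, ?_, fun v => ⟨ExtMod.mono (Module.finBasis ℂ L.gneg) (e v), ?_⟩⟩
  · rw [← LinearMap.ker_eq_bot]
    by_contra h0
    obtain ⟨m, ⟨hm, hinv⟩, hm0⟩ := (Submodule.ne_bot_iff _).1
      (W.kac.exists_mem_invNeg Ψ.isSubmod_ker h0)
    obtain ⟨w, rfl⟩ := ExtMod.exists_eq_mono_of_lmul_eq_zero (m := m)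
      (fun y => (W.kac_act_neg y.2 m).symm.trans (hinv y y.2))
    have h := hΨ (ExtMod.mono (Module.finBasis ℂ L.gneg) w)
    rw [LinearMap.mem_ker.1 hm, map_zero, htop, eq_comm, LinearEquiv.map_eq_zero_iff] at h
    exact hm0 (by rw [h, ExtMod.mono, map_zero]; rfl)
  · exact (hΨ _).trans ((htop _).trans (e.symm_apply_apply v))

theorem IsCoindPos.top_ne_bot {V : SMod0 L} {C : SMod L} {ε : C.carrier →ₗ[ℂ] V.carrier}
    (hC : IsCoindPos V C ε) (hV : V.IsSimple) : (⊤ : Submodule ℂ C.carrier) ≠ ⊥ := by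
  obtain ⟨W, hT⟩ := exists_twist V
  obtain ⟨Ψ, -, hs⟩ := exists_kac_injective_coind hC hT
  intro h
  refine hV.1 (eq_bot_iff.2 fun v _ => ?_)
  obtain ⟨m, rfl⟩ := hs v
  have : Ψ.toLin m ∈ (⊤ : Submodule ℂ C.carrier) := trivial
  rw [h, Submodule.mem_bot] at this
  rw [this, map_zero]
  exact zero_mem _

end Twist

namespace SMod

variable {L : GLSA} (M : SMod L)

/-- A graded `𝔤₀`-stable subspace. -/
def IsStable0 (Q : Submodule ℂ M.carrier) : Prop :=
  (∀ x ∈ L.g0, ∀ m ∈ Q, M.act x m ∈ Q) ∧ ∀ m ∈ Q, M.par m ∈ Q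

variable {M}

theorem IsStable0.sSup_of_directedOn {c : Set (Submodule ℂ M.carrier)} (hne : c.Nonempty)
    (hd : DirectedOn (· ≤ ·) c) (h : ∀ Q ∈ c, M.IsStable0 Q) : M.IsStable0 (sSup c) := by
  refine ⟨fun x hx m hm => ?_, fun m hm => ?_⟩ <;>
    obtain ⟨Q, hQ, hmQ⟩ := (Submodule.mem_sSup_of_directed hne hd).1 hm
  · exact (Submodule.mem_sSup_of_directed hne hd).2 ⟨Q, hQ, (h Q hQ).1 x hx m hmQ⟩
  · exact (Submodule.mem_sSup_of_directed hne hd).2 ⟨Q, hQ, (h Q hQ).2 m hmQ⟩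

variable (M)

/-- A simple supermodule is finitely generated over `𝔤₀`, up to parity. -/
theorem exists_fg_generating [FiniteDimensional ℂ L.gneg] [FiniteDimensional ℂ L.gpos]
    (hM : M.IsSimple) : ∃ D : Submodule ℂ M.carrier, D.FG ∧
      ∀ Q, M.IsStable0 Q → D ≤ Q → Q = ⊤ := by
  obtain ⟨s, -, hs⟩ := (Submodule.ne_bot_iff _).1 hM.1
  obtain ⟨D₁, hD₁, hle, hn⟩ := exists_fg_stable M.actNeg_sq (Submodule.fg_span_singleton s)
  obtain ⟨D', hD', hle', hp'⟩ := exists_fg_stable M.actPos_sq hD₁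
  set D := opClosure (M.ops L.gpos) D₁
  have hDD' : D ≤ D' := opClosure_le hle' (by
    rintro _ ⟨x, hx, rfl⟩ m - hm
    exact hp' ⟨x, hx⟩ m hm)
  have hDp : ∀ x ∈ L.gpos, ∀ m ∈ D, M.act x m ∈ D := fun x hx m hm =>
    map_mem_opClosure (show M.act x ∈ M.ops L.gpos from ⟨x, hx, rfl⟩) hm
  refine ⟨D, ?_, ?_⟩
  · have : FiniteDimensional ℂ D' := Module.Finite.iff_fg.2 hD'
    exact Module.Finite.iff_fg.1 (Submodule.finiteDimensional_of_le hDD')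
  let R := opClosure (M.ops L.g0 ∪ {M.par}) D
  have hDR : D ≤ R := le_opClosure _ _
  have hR0 : ∀ x ∈ L.g0, ∀ m ∈ R, M.act x m ∈ R := fun x hx m hm =>
    map_mem_opClosure (show M.act x ∈ M.ops L.g0 ∪ {M.par} from Or.inl ⟨x, hx, rfl⟩) hm
  have hRσ : ∀ m ∈ R, M.par m ∈ R := fun m hm =>
    map_mem_opClosure (show M.par ∈ M.ops L.g0 ∪ {M.par} from Or.inr rfl) hm
  have hodd : ∀ A ≤ L.odd, (∀ x ∈ L.g0, ∀ y ∈ A, L.bracket x y ∈ A) →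
      D ≤ M.transporter A R → R ≤ M.transporter A R := by
    intro A hA hbr hD
    refine opClosure_le hD ?_
    rintro _ (⟨x, hx, rfl⟩ | rfl) m - hm <;> rw [SMod.mem_transporter] at hm ⊢ <;> intro y hy
    · rw [M.act_act_even hx]
      exact R.sub_mem (hR0 x hx _ (hm y hy)) (hm _ (hbr x hx y hy))
    · rw [M.act_par_odd (hA hy)]
      exact R.neg_mem (hRσ _ (hm y hy))
  have hRp := hodd L.gpos L.gpos_le_odd L.br_0p fun m hm =>
    SMod.mem_transporter.2 fun x hx => hDR (hDp x hx m hm)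
  have hRn := hodd L.gneg L.gneg_le_odd L.br_0n <| by
    refine opClosure_le
      (fun m hm => SMod.mem_transporter.2 fun y hy => hDR (le_opClosure _ _ (hn ⟨y, hy⟩ m hm))) ?_
    rintro _ ⟨x, hx, rfl⟩ m hmD hm
    rw [SMod.mem_transporter] at hm ⊢
    intro y hy
    rw [M.act_act_odd (L.gpos_le_odd hx) (L.gneg_le_odd hy)]
    exact R.sub_mem (hR0 _ (L.br_pn x hx y hy) m (hDR hmD))
      (SMod.mem_transporter.1 (hRp (hm y hy)) x hx)
  have hsub : M.IsSubmod R := M.isSubmod_of_pieces hR0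
    (fun y hy m hm => SMod.mem_transporter.1 (hRn hm) y hy)
    (fun x hx m hm => SMod.mem_transporter.1 (hRp hm) x hx) hRσ
  have htop : R = ⊤ := (hM.2 R hsub).resolve_left fun h => hs <| by
    have : s ∈ R := hDR (le_opClosure _ _ (hle (Submodule.mem_span_singleton_self s)))
    rwa [h, Submodule.mem_bot] at this
  intro Q hQ hDQ
  refine eq_top_iff.2 (htop ▸ opClosure_le hDQ ?_)
  rintro _ (⟨x, hx, rfl⟩ | rfl) m - hm
  · exact hQ.1 x hx m hm
  · exact hQ.2 m hm

/-- The space `𝔤₁ · M`. -/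
def posImage : Submodule ℂ M.carrier := Submodule.span ℂ {m | ∃ (x : L.gpos) (n : M.carrier),
  m = M.actPos x n}

theorem isStable0_posImage : M.IsStable0 M.posImage := by
  refine ⟨fun x hx => ?_, ?_⟩
  · suffices M.posImage ≤ M.posImage.comap (M.act x) from this
    refine Submodule.span_le.2 ?_
    rintro _ ⟨y, n, rfl⟩
    have h := M.act_br_e x y (Or.inl hx) n
    rw [eq_sub_iff_add_eq] at h
    refine Submodule.mem_comap.2 ?_
    refine (congrArg (· ∈ M.posImage) h).mp (add_mem ?_ ?_)
    · exact Submodule.subset_span ⟨⟨_, L.br_0p x hx y y.2⟩, n, rfl⟩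
    · exact Submodule.subset_span ⟨y, _, rfl⟩
  · suffices M.posImage ≤ M.posImage.comap M.par from this
    refine Submodule.span_le.2 ?_
    rintro _ ⟨y, n, rfl⟩
    refine Submodule.mem_comap.2 ?_
    rw [← neg_neg (M.par _)]
    exact neg_mem ((congrArg (· ∈ M.posImage) (M.act_par_odd (L.gpos_le_odd y.2) n)).mp
      (Submodule.subset_span ⟨y, _, rfl⟩))

/-- A simple supermodule has a maximal proper graded `𝔤₀`-stable subspace containing
`𝔤₁ · M`. -/
theorem exists_maximal_isStable0 [FiniteDimensional ℂ L.gneg] [FiniteDimensional ℂ L.gpos]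
    (hM : M.IsSimple) : ∃ Q, M.posImage ≤ Q ∧ Q ≠ ⊤ ∧ M.IsStable0 Q ∧
      ∀ Q', M.IsStable0 Q' → Q ≤ Q' → Q' = Q ∨ Q' = ⊤ := by
  obtain ⟨D, hD, hgen⟩ := M.exists_fg_generating hM
  have : Nontrivial M.carrier := (Submodule.nontrivial_iff ℂ).1 ⟨_, _, hM.1⟩
  have hub : ∀ c ⊆ {Q | Q ≠ ⊤ ∧ M.IsStable0 Q}, IsChain (· ≤ ·) c → ∀ y ∈ c,
      ∃ ub ∈ {Q | Q ≠ ⊤ ∧ M.IsStable0 Q}, ∀ z ∈ c, z ≤ ub := by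
    refine fun c hc hchain y hy => ⟨sSup c, ⟨fun htop => ?_,
      IsStable0.sSup_of_directedOn ⟨y, hy⟩ hchain.directedOn fun Q hQ => (hc hQ).2⟩,
      fun z hz => le_sSup hz⟩
    obtain ⟨Q, hQ, hDQ⟩ := (CompleteLattice.isCompactElement_iff_le_of_directed_sSup_le _ _).1
      ((Submodule.fg_iff_compact D).1 hD) c ⟨y, hy⟩ hchain.directedOn (htop ▸ le_top)
    exact (hc hQ).1 (hgen Q (hc hQ).2 hDQ)
  obtain ⟨Q, hle, hmax⟩ := zorn_le_nonempty₀ _ hub M.posImage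
    ⟨span_range_ne_top M.actPos_sq, M.isStable0_posImage⟩
  refine ⟨Q, hle, hmax.1.1, hmax.1.2, fun Q' hQ' hQQ' => or_iff_not_imp_right.2 fun h => ?_⟩
  exact le_antisymm (hmax.2 ⟨h, hQ'⟩ hQQ') hQQ'

variable {M}

/-- The quotient by a graded `𝔤₀`-stable subspace. -/
def IsStable0.quotient {Q : Submodule ℂ M.carrier} (hQ : M.IsStable0 Q) : SMod0 L where
  carrier := M.carrier ⧸ Q
  act := LinearMap.mk₂ ℂ (fun x => Q.mapQ Q (M.act x) (hQ.1 x x.2))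
    (fun x y m => by induction m using Submodule.Quotient.induction_on; simp)
    (fun c x m => by induction m using Submodule.Quotient.induction_on; simp)
    (fun x m n => map_add _ m n) (fun c x m => map_smul _ c m)
  ev := plusSpace (Q.mapQ Q M.par hQ.2)
  od := minusSpace (Q.mapQ Q M.par hQ.2)
  grading := isCompl_plusSpace_minusSpace fun m => by
    induction m using Submodule.Quotient.induction_on; simp [M.par_par]
  act_ev x m := by
    induction m using Submodule.Quotient.induction_on with | _ m
    simp only [mem_plusSpace, LinearMap.mk₂_apply, Submodule.mapQ_apply, ← M.act_par_even x.2]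
    intro h
    have := congrArg (Q.mapQ Q (M.act x) (hQ.1 x x.2)) h
    simpa only [Submodule.mapQ_apply] using this
  act_od x m := by
    induction m using Submodule.Quotient.induction_on with | _ m
    simp only [mem_minusSpace, LinearMap.mk₂_apply, Submodule.mapQ_apply, ← M.act_par_even x.2]
    intro h
    have := congrArg (Q.mapQ Q (M.act x) (hQ.1 x x.2)) h
    simpa only [Submodule.mapQ_apply, map_neg] using this
  act_br x y m := by
    induction m using Submodule.Quotient.induction_on with | _ m
    simp only [LinearMap.mk₂_apply, Submodule.mapQ_apply, M.act_br_e x y (Or.inl x.2),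
      Submodule.Quotient.mk_sub]

theorem IsStable0.quotient_par {Q : Submodule ℂ M.carrier} (hQ : M.IsStable0 Q) (m : M.carrier) :
    hQ.quotient.par (Q.mkQ m) = Q.mkQ (M.par m) :=
  parityOp_plusSpace_minusSpace (σ := Q.mapQ Q M.par hQ.2)
    (fun m => by induction m using Submodule.Quotient.induction_on; simp [M.par_par]) _

theorem IsStable0.quotient_isSimple {Q : Submodule ℂ M.carrier} (hQ : M.IsStable0 Q) (hne : Q ≠ ⊤)
    (hmax : ∀ Q', M.IsStable0 Q' → Q ≤ Q' → Q' = Q ∨ Q' = ⊤) : hQ.quotient.IsSimple := by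
  refine ⟨fun h => hne ?_, fun N hN => ?_⟩
  · refine eq_top_iff.2 fun m _ => ?_
    exact (Submodule.Quotient.mk_eq_zero Q).1 ((Submodule.mem_bot ℂ).1
      (h.le (Submodule.mem_top (x := (Q.mkQ m : hQ.quotient.carrier)))))
  · replace hN := (hQ.quotient.isSubmod_iff N).1 hN
    change Submodule ℂ (M.carrier ⧸ Q) at N
    have hst : M.IsStable0 (N.comap Q.mkQ) := ⟨fun x hx m hm => hN.1 ⟨x, hx⟩ _ hm,
      fun m hm => (congrArg (· ∈ N) (hQ.quotient_par m)).mp (hN.2 _ hm)⟩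
    have hmap : (N.comap Q.mkQ).map Q.mkQ = N :=
      Submodule.map_comap_eq_of_surjective Q.mkQ_surjective N
    refine (hmax _ hst (Submodule.le_comap_mkQ Q N)).imp (fun h => ?_) fun h => ?_
    · exact hmap.symm.trans ((congrArg (Submodule.map Q.mkQ) h).trans (Submodule.mkQ_map_self Q))
    · rw [h, Submodule.map_top, Submodule.range_mkQ] at hmap
      exact hmap.symm

end SMod

/-- Every simple supermodule is the socle of a module coinduced from a simple module. -/
theorem exists_coind_socle {L : GLSA} [FiniteDimensional ℂ L.gneg] [FiniteDimensional ℂ L.gpos]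
    (S : SMod L) (hS : S.IsSimple) : ∃ V : SMod0 L, V.IsSimple ∧
      ∃ (C : SMod L) (ε : C.carrier →ₗ[ℂ] V.carrier), IsCoindPos V C ε ∧
        ∃ f : SHom S C, Injective f.toLin ∧ LinearMap.range f.toLin = C.socle := by
  obtain ⟨Q, hle, hne, hQ, hmax⟩ := S.exists_maximal_isStable0 hS
  have hV := hQ.quotient_isSimple hne hmax
  have hC := hQ.quotient.isCoindPos_coind
  refine ⟨hQ.quotient, hV, _, _, hC, ?_⟩
  obtain ⟨f, hf, -⟩ := hC.universal S Q.mkQ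
    (fun m hm => (parityOp_eq_self_iff hQ.quotient.grading).1
      ((hQ.quotient_par m).trans (congrArg Q.mkQ (parityOp_left _ hm))))
    (fun m hm => (parityOp_eq_neg_iff hQ.quotient.grading).1
      ((hQ.quotient_par m).trans ((congrArg Q.mkQ (parityOp_right _ hm)).trans (map_neg _ _))))
    (fun _ _ => rfl)
    (fun x hx m => (Submodule.Quotient.mk_eq_zero Q).2
      (hle (Submodule.subset_span ⟨⟨x, hx⟩, m, rfl⟩)))
  have h0 : f.toLin ≠ 0 := fun h => hne <| eq_top_iff.2 fun m _ => by
    have := hf m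
    rw [h, LinearMap.zero_apply, map_zero] at this
    exact (Submodule.Quotient.mk_eq_zero Q).1 this.symm
  have hinj : Injective f.toLin := LinearMap.ker_eq_bot.1
    ((hS.2 _ f.isSubmod_ker).resolve_right fun h => h0 (LinearMap.ker_eq_top.1 h))
  refine ⟨f, hinj, ?_⟩
  have hleast := hC.isLeast_gen_invNeg hV (hC.top_ne_bot hV)
  rw [hleast.socle_eq]
  refine le_antisymm ?_ (hleast.2.2 _ f.isSubmod_range fun h => h0 (LinearMap.range_eq_bot.1 h))
  have hpre := f.isLeast_comap hinj hS.1 hleast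
  rw [LinearMap.range_eq_map, ← (hS.2 _ hpre.1).resolve_left hpre.2.1]
  exact Submodule.map_comap_le _ _

/-- Theorem A, part 2: The correspondence
`V ↦ Soc(Coind_{𝔤≥0}^𝔤(V)) ≅ Soc(K(V ⊗ Λ^max(𝔤₋₁^*)))` induces a bijection between the
set of isomorphism classes of simple `𝔤₀̄`-supermodules and the set of isomorphism
classes of simple `𝔤`-supermodules.  (Both socles appearing are simple.) -/
theorem statement_11 (L : GLSA)
    [FiniteDimensional ℂ ↥L.gneg] [FiniteDimensional ℂ ↥L.gpos] :
    -- well-definedness: the socle is simple, and the two descriptions agree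
    (∀ V : SMod0 L, V.IsSimple →
      ∀ (C : SMod L) (ε : C.carrier →ₗ[ℂ] V.carrier), IsCoindPos V C ε →
        C.IsSimpleSub C.socle ∧
        (∀ W : SMod0 L, IsTwistBy V W (fun x => -(traceCharNeg L x)) (parNeg L) →
          ∀ (K : SMod L) (η : W.carrier →ₗ[ℂ] K.carrier), IsKac W K η →
            K.IsSimpleSub K.socle ∧
            ∃ S : SMod L,
              (∃ f : SHom S C, Injective f.toLin ∧ LinearMap.range f.toLin = C.socle) ∧
              (∃ g : SHom S K, Injective g.toLin ∧ LinearMap.range g.toLin = K.socle))) ∧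
    -- injectivity on isomorphism classes
    (∀ (V V' : SMod0 L), V.IsSimple → V'.IsSimple →
      ∀ (C : SMod L) (ε : C.carrier →ₗ[ℂ] V.carrier), IsCoindPos V C ε →
      ∀ (C' : SMod L) (ε' : C'.carrier →ₗ[ℂ] V'.carrier), IsCoindPos V' C' ε' →
        (∃ S : SMod L,
          (∃ f : SHom S C, Injective f.toLin ∧ LinearMap.range f.toLin = C.socle) ∧
          (∃ g : SHom S C', Injective g.toLin ∧ LinearMap.range g.toLin = C'.socle)) →
        SIso0 V V') ∧
    -- surjectivity onto isomorphism classes of simple 𝔤-supermodules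
    (∀ S : SMod L, S.IsSimple →
      ∃ V : SMod0 L, V.IsSimple ∧
        ∃ (C : SMod L) (ε : C.carrier →ₗ[ℂ] V.carrier), IsCoindPos V C ε ∧
          ∃ f : SHom S C, Injective f.toLin ∧ LinearMap.range f.toLin = C.socle) := by
  refine ⟨fun V hV C ε hC => ?_, ?_, exists_coind_socle⟩
  · have hleast := hC.isLeast_gen_invNeg hV (hC.top_ne_bot hV)
    refine ⟨hleast.socle_eq.symm ▸ hleast.isSimpleSub, fun W hT K η hK => ?_⟩
    obtain ⟨Φ, hΦ⟩ := hK.exists_injective_kac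
    obtain ⟨Ψ, hΨ, -⟩ := exists_kac_injective_coind hC hT
    have hinj : Injective (Ψ.comp Φ).toLin := hΨ.comp hΦ
    have h0 : (⊤ : Submodule ℂ K.carrier) ≠ ⊥ := fun h => hV.1 <| eq_bot_iff.2 fun v _ => by
      obtain ⟨e, -⟩ := hT
      have hηv : η (e v) ∈ (⊥ : Submodule ℂ K.carrier) := h ▸ Submodule.mem_top
      rw [Submodule.mem_bot] at hηv ⊢
      exact e.map_eq_zero_iff.1 (hK.injective (hηv.trans (map_zero η).symm))
    have hK' := (Ψ.comp Φ).isLeast_comap hinj h0 hleast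
    have hle := hleast.2.2 _ (Ψ.comp Φ).isSubmod_range fun h => h0 <|
      LinearMap.ker_eq_top.2 (LinearMap.range_eq_bot.1 h) ▸ LinearMap.ker_eq_bot.2 hinj
    refine ⟨hK'.socle_eq.symm ▸ hK'.isSimpleSub, K.sub _ hK'.1,
      ⟨(Ψ.comp Φ).comp (K.subIncl _ hK'.1), hinj.comp Subtype.val_injective, ?_⟩,
      ⟨K.subIncl _ hK'.1, Subtype.val_injective, ?_⟩⟩
    · rw [hleast.socle_eq]
      exact (LinearMap.range_comp _ _).trans ((congrArg (Submodule.map _)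
        (Submodule.range_subtype _)).trans (Submodule.map_comap_eq_of_le hle))
    · rw [hK'.socle_eq]
      exact Submodule.range_subtype _
  · rintro V V' hV hV' C ε hC C' ε' hC' ⟨S, ⟨f, hf, hfr⟩, g, hg, hgr⟩
    have hleast := hC.isLeast_gen_invNeg hV (hC.top_ne_bot hV)
    have hleast' := hC'.isLeast_gen_invNeg hV' (hC'.top_ne_bot hV')
    refine sIso0_of_common_submodule hV hV' hC hC' f hf g hg ?_ ?_
    · rw [hfr, hleast.socle_eq]
      exact hleast.2.1
    · rw [hgr, hleast'.socle_eq]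
      exact hleast'.2.1
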